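/- arXiv:math/0305336 — 2 statements merged into one kernel-verified Lean document; each statement's English description precedes it below -/
import Mathlib

section
/- Let 𝒜 be a central hyperplane arrangement in ℝⁿ with base region B. If 𝒜 = I₁ ∪ I₂ ∪ ⋯ ∪ I_k is a partition such that for each j the set I_j induces an acyclic sub-digraph of the basic digraph 𝒟(𝒜,B), then the order dimension of the poset of regions 𝒫(𝒜,B) is at most k. -/
open scoped RealInnerProductSpace

noncomputable section

variable {n : ℕ}

/-- A (linear) hyperplane in ℝⁿ: the zero set of a nonzero linear functional,
expressed via the inner product with a nonzero normal vector. -/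
def IsHyperplane (H : Set (EuclideanSpace ℝ (Fin n))) : Prop :=
  ∃ v : EuclideanSpace ℝ (Fin n), v ≠ 0 ∧ H = {x | ⟪v, x⟫ = 0}

/-- A central hyperplane arrangement: a finite nonempty collection of linear hyperplanes. -/
def IsCentralArrangement (A : Set (Set (EuclideanSpace ℝ (Fin n)))) : Prop :=
  A.Finite ∧ A.Nonempty ∧ ∀ H ∈ A, IsHyperplane H

/-- The complement of the union of the hyperplanes of the arrangement. -/
def arrComplement (A : Set (Set (EuclideanSpace ℝ (Fin n)))) : Set (EuclideanSpace ℝ (Fin n)) :=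
  (⋃ H ∈ A, H)ᶜ

/-- A region of the arrangement: the closure of a connected component of the complement
of the union of the hyperplanes. -/
def IsRegion (A : Set (Set (EuclideanSpace ℝ (Fin n)))) (R : Set (EuclideanSpace ℝ (Fin n))) :
    Prop :=
  ∃ x ∈ arrComplement A, R = closure (connectedComponentIn (arrComplement A) x)

/-- The hyperplane `H` separates the region `R` from the region `B`: their interiors lie on
strictly opposite sides of `H`. -/
def Separates (H R B : Set (EuclideanSpace ℝ (Fin n))) : Prop :=
  ∃ v : EuclideanSpace ℝ (Fin n), v ≠ 0 ∧ H = {x | ⟪v, x⟫ = 0} ∧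
    (∀ x ∈ interior R, 0 < ⟪v, x⟫) ∧ (∀ x ∈ interior B, ⟪v, x⟫ < 0)

/-- S(R): the set of hyperplanes of `A` separating `R` from the base region `B`. -/
def sepSet (A : Set (Set (EuclideanSpace ℝ (Fin n)))) (B R : Set (EuclideanSpace ℝ (Fin n))) :
    Set (Set (EuclideanSpace ℝ (Fin n))) :=
  {H | H ∈ A ∧ Separates H R B}

/-- The order of the poset of regions 𝒫(𝒜,B): containment of separating sets. -/
def regLE (A : Set (Set (EuclideanSpace ℝ (Fin n)))) (B R₁ R₂ : Set (EuclideanSpace ℝ (Fin n))) :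
    Prop :=
  sepSet A B R₁ ⊆ sepSet A B R₂

/-- Strict order on regions. -/
def regLT (A : Set (Set (EuclideanSpace ℝ (Fin n)))) (B R₁ R₂ : Set (EuclideanSpace ℝ (Fin n))) :
    Prop :=
  regLE A B R₁ R₂ ∧ ¬ regLE A B R₂ R₁

/-- The order dimension of the poset of regions 𝒫(𝒜,B): the smallest `d` such that it embeds
as an induced subposet of ℝᵈ with the componentwise order. -/
def regionOrderDim (A : Set (Set (EuclideanSpace ℝ (Fin n))))
    (B : Set (EuclideanSpace ℝ (Fin n))) : ℕ :=
  sInf {d : ℕ | ∃ f : {R : Set (EuclideanSpace ℝ (Fin n)) // IsRegion A R} → (Fin d → ℝ),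
    ∀ R₁ R₂, regLE A B R₁.1 R₂.1 ↔ ∀ i, f R₁ i ≤ f R₂ i}

/-- The rank-two subarrangement of `A` consisting of all hyperplanes of `A`
containing `H₁ ∩ H₂`. -/
def pencil (A : Set (Set (EuclideanSpace ℝ (Fin n)))) (H₁ H₂ : Set (EuclideanSpace ℝ (Fin n))) :
    Set (Set (EuclideanSpace ℝ (Fin n))) :=
  {H | H ∈ A ∧ H₁ ∩ H₂ ⊆ H}

/-- `H` is basic in the subarrangement `A'` relative to the base region `B`:
`H ∈ A'` and `H` bounds (meets in codimension one) the region `B'` of `A'` containing `B`. -/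
def IsBasicIn (A' : Set (Set (EuclideanSpace ℝ (Fin n)))) (B H : Set (EuclideanSpace ℝ (Fin n))) :
    Prop :=
  H ∈ A' ∧ ∃ B', IsRegion A' B' ∧ B ⊆ B' ∧
    Submodule.span ℝ (H ∩ B') = Submodule.span ℝ H

/-- The edge relation of the basic digraph 𝒟(𝒜,B): `H₁ → H₂` whenever `H₁` is basic in the
rank-two subarrangement consisting of all hyperplanes of `A` containing `H₁ ∩ H₂`. -/
def BasicEdge (A : Set (Set (EuclideanSpace ℝ (Fin n))))
    (B H₁ H₂ : Set (EuclideanSpace ℝ (Fin n))) : Prop :=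
  H₁ ∈ A ∧ H₂ ∈ A ∧ H₁ ≠ H₂ ∧ IsBasicIn (pencil A H₁ H₂) B H₁

/-- A finite acyclic relation admits positive weights such that the weight of each element
exceeds the total weight of its successors. -/
theorem exists_weight_of_acyclic {α : Type*} [Fintype α] (r : α → α → Prop)
    (hr : ∀ a, ¬ Relation.TransGen r a a) :
    ∃ w : α → ℝ, (∀ a, 0 < w a) ∧ ∀ a (s : Finset α), (∀ b ∈ s, r a b) → ∑ b ∈ s, w b < w a := by
  classical
  let N : α → ℕ := fun a => (Finset.univ.filter fun b => Relation.TransGen r a b).card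
  have hN : ∀ a b, r a b → N b < N a := by
    intro a b hab
    apply Finset.card_lt_card
    rw [Finset.ssubset_iff_of_subset]
    · exact ⟨b, by simpa using Relation.TransGen.single hab, by simpa using hr b⟩
    · intro c hc
      simp only [Finset.mem_filter, Finset.mem_univ, true_and] at hc ⊢
      exact Relation.TransGen.head hab hc
  have hc : (1 : ℝ) ≤ (Fintype.card α : ℝ) + 1 := by simp
  refine ⟨fun a => ((Fintype.card α : ℝ) + 1) ^ N a, fun a => by positivity, fun a s hs => ?_⟩
  rcases s.eq_empty_or_nonempty with rfl | ⟨b₀, hb₀⟩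
  · simp only [Finset.sum_empty]
    positivity
  have hpos : N a = (N a - 1) + 1 := by have := hN a b₀ (hs b₀ hb₀); omega
  calc ∑ b ∈ s, ((Fintype.card α : ℝ) + 1) ^ N b
      ≤ ∑ _b ∈ s, ((Fintype.card α : ℝ) + 1) ^ (N a - 1) := by
        refine Finset.sum_le_sum fun b hb => pow_le_pow_right₀ hc ?_
        have := hN a b (hs b hb)
        omega
    _ = (s.card : ℝ) * ((Fintype.card α : ℝ) + 1) ^ (N a - 1) := by simp
    _ < ((Fintype.card α : ℝ) + 1) * ((Fintype.card α : ℝ) + 1) ^ (N a - 1) := by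
        gcongr
        have : (s.card : ℝ) ≤ Fintype.card α := by exact_mod_cast Finset.card_le_univ s
        linarith
    _ = ((Fintype.card α : ℝ) + 1) ^ N a := by
        conv_rhs => rw [hpos]
        ring

/-- A hyperplane avoiding `b` has a normal vector `u` with `⟪u, b⟫ = -1`. -/
theorem IsHyperplane.exists_normalized {H : Set (EuclideanSpace ℝ (Fin n))}
    (hH : IsHyperplane H) {b : EuclideanSpace ℝ (Fin n)} (hb : b ∉ H) :
    ∃ u : EuclideanSpace ℝ (Fin n), H = {x | ⟪u, x⟫ = 0} ∧ ⟪u, b⟫ = -1 := by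
  obtain ⟨v, -, rfl⟩ := hH
  have hvb : ⟪v, b⟫ ≠ 0 := hb
  refine ⟨(-⟪v, b⟫⁻¹) • v, ?_, ?_⟩
  · ext x
    simp [real_inner_smul_left, hvb]
  · simp [real_inner_smul_left, hvb]

theorem mem_arrComplement {A : Set (Set (EuclideanSpace ℝ (Fin n)))}
    {x : EuclideanSpace ℝ (Fin n)} : x ∈ arrComplement A ↔ ∀ H ∈ A, x ∉ H := by
  simp [arrComplement]

/-- A preconnected set missing a hyperplane lies on one side of it. -/
theorem IsPreconnected.inner_pos_of_inner_pos {S : Set (EuclideanSpace ℝ (Fin n))}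
    (hS : IsPreconnected S) {v x y : EuclideanSpace ℝ (Fin n)} (h0 : ∀ z ∈ S, ⟪v, z⟫ ≠ 0)
    (hx : x ∈ S) (hy : y ∈ S) (hvx : 0 < ⟪v, x⟫) : 0 < ⟪v, y⟫ := by
  by_contra hvy
  obtain ⟨z, hz, hz0⟩ := hS.intermediate_value hy hx
    (f := fun z => ⟪v, z⟫) (by fun_prop) ⟨not_lt.1 hvy, hvx.le⟩
  exact h0 z hz hz0

/-- The open cell of points on the same side as `x` of every hyperplane with normal `u H`. -/
def openCell (A : Set (Set (EuclideanSpace ℝ (Fin n))))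
    (u : Set (EuclideanSpace ℝ (Fin n)) → EuclideanSpace ℝ (Fin n))
    (x : EuclideanSpace ℝ (Fin n)) : Set (EuclideanSpace ℝ (Fin n)) :=
  ⋂ H ∈ A, {y | 0 < ⟪⟪u H, x⟫ • u H, y⟫}

theorem mem_openCell {A : Set (Set (EuclideanSpace ℝ (Fin n)))}
    {u : Set (EuclideanSpace ℝ (Fin n)) → EuclideanSpace ℝ (Fin n)}
    {x y : EuclideanSpace ℝ (Fin n)} :
    y ∈ openCell A u x ↔ ∀ H ∈ A, 0 < ⟪u H, x⟫ * ⟪u H, y⟫ := by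
  simp [openCell, real_inner_smul_left]

theorem convex_openCell (A : Set (Set (EuclideanSpace ℝ (Fin n))))
    (u : Set (EuclideanSpace ℝ (Fin n)) → EuclideanSpace ℝ (Fin n))
    (x : EuclideanSpace ℝ (Fin n)) : Convex ℝ (openCell A u x) :=
  convex_iInter₂ fun _ _ => convex_halfSpace_gt (innerₗ _ _).isLinear 0

theorem isOpen_openCell {A : Set (Set (EuclideanSpace ℝ (Fin n)))} (hA : A.Finite)
    (u : Set (EuclideanSpace ℝ (Fin n)) → EuclideanSpace ℝ (Fin n))
    (x : EuclideanSpace ℝ (Fin n)) : IsOpen (openCell A u x) :=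
  hA.isOpen_biInter fun _ _ => isOpen_lt continuous_const (by fun_prop)

theorem mem_openCell_self {A : Set (Set (EuclideanSpace ℝ (Fin n)))}
    {u : Set (EuclideanSpace ℝ (Fin n)) → EuclideanSpace ℝ (Fin n)}
    (hu : ∀ H ∈ A, H = {z | ⟪u H, z⟫ = 0})
    {x : EuclideanSpace ℝ (Fin n)} (hx : x ∈ arrComplement A) : x ∈ openCell A u x := by
  refine mem_openCell.2 fun H hH => mul_self_pos.2 fun h => ?_
  refine mem_arrComplement.1 hx H hH ?_
  rw [hu H hH]
  exact h

theorem openCell_subset_connectedComponentIn {A : Set (Set (EuclideanSpace ℝ (Fin n)))}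
    {u : Set (EuclideanSpace ℝ (Fin n)) → EuclideanSpace ℝ (Fin n)}
    (hu : ∀ H ∈ A, H = {z | ⟪u H, z⟫ = 0})
    {x : EuclideanSpace ℝ (Fin n)} (hx : x ∈ arrComplement A) :
    openCell A u x ⊆ connectedComponentIn (arrComplement A) x := by
  refine (convex_openCell A u x).isPreconnected.subset_connectedComponentIn
    (mem_openCell_self hu hx) fun y hy => mem_arrComplement.2 fun H hH hyH => ?_
  rw [hu H hH] at hyH
  have h := mem_openCell.1 hy H hH
  rw [show ⟪u H, y⟫ = 0 from hyH, mul_zero] at h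
  exact lt_irrefl _ h

theorem connectedComponentIn_eq_openCell {A : Set (Set (EuclideanSpace ℝ (Fin n)))}
    {u : Set (EuclideanSpace ℝ (Fin n)) → EuclideanSpace ℝ (Fin n)}
    (hu : ∀ H ∈ A, H = {z | ⟪u H, z⟫ = 0})
    {x : EuclideanSpace ℝ (Fin n)} (hx : x ∈ arrComplement A) :
    connectedComponentIn (arrComplement A) x = openCell A u x := by
  refine Set.Subset.antisymm (fun y hy => ?_) (openCell_subset_connectedComponentIn hu hx)
  refine mem_openCell.2 fun H hH => ?_
  have hxx := mem_openCell.1 (mem_openCell_self hu hx) H hH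
  rw [← real_inner_smul_left] at hxx ⊢
  refine isPreconnected_connectedComponentIn.inner_pos_of_inner_pos (fun z hz h0 => ?_)
    (mem_connectedComponentIn hx) hy hxx
  rw [real_inner_smul_left] at h0 hxx
  rcases mul_eq_zero.1 h0 with h | h
  · rw [h, zero_mul] at hxx
    exact lt_irrefl _ hxx
  · refine mem_arrComplement.1 (connectedComponentIn_subset _ _ hz) H hH ?_
    rw [hu H hH]
    exact h

/-- The interior of the region of `x` is the open cell of `x`. -/
theorem interior_closure_connectedComponentIn {A : Set (Set (EuclideanSpace ℝ (Fin n)))}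
    (hA : A.Finite) {u : Set (EuclideanSpace ℝ (Fin n)) → EuclideanSpace ℝ (Fin n)}
    (hu : ∀ H ∈ A, H = {z | ⟪u H, z⟫ = 0})
    {x : EuclideanSpace ℝ (Fin n)} (hx : x ∈ arrComplement A) :
    interior (closure (connectedComponentIn (arrComplement A) x)) = openCell A u x := by
  have ho := isOpen_openCell hA u x
  rw [connectedComponentIn_eq_openCell hu hx,
    (convex_openCell A u x).interior_closure_eq_interior_of_nonempty_interior, ho.interior_eq]
  rw [ho.interior_eq]
  exact ⟨x, mem_openCell_self hu hx⟩

/-- With normals negative on the base point, a hyperplane separates the region of `x` from the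
base region iff its normal is positive on `x`. -/
theorem mem_sepSet_iff {A : Set (Set (EuclideanSpace ℝ (Fin n)))}
    (hA : A.Finite) {u : Set (EuclideanSpace ℝ (Fin n)) → EuclideanSpace ℝ (Fin n)}
    (hu : ∀ H ∈ A, H = {z | ⟪u H, z⟫ = 0}) {b x : EuclideanSpace ℝ (Fin n)}
    (hub : ∀ H ∈ A, ⟪u H, b⟫ = -1)
    (hb : b ∈ arrComplement A) (hx : x ∈ arrComplement A)
    {H : Set (EuclideanSpace ℝ (Fin n))} (hH : H ∈ A) :
    H ∈ sepSet A (closure (connectedComponentIn (arrComplement A) b))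
      (closure (connectedComponentIn (arrComplement A) x)) ↔ 0 < ⟪u H, x⟫ := by
  simp only [sepSet, Separates, Set.mem_ofPred_eq, interior_closure_connectedComponentIn hA hu hb,
    interior_closure_connectedComponentIn hA hu hx, hH, true_and]
  constructor
  · rintro ⟨w, -, hw, hwx, hwb⟩
    have hx' := hwx x (mem_openCell_self hu hx)
    have hb' := hwb b (mem_openCell_self hu hb)
    have hz : (-⟪w, b⟫) • x + ⟪w, x⟫ • b ∈ H := by
      rw [hw]
      simp only [Set.mem_ofPred_eq, inner_add_right, real_inner_smul_right]
      ring
    rw [hu H hH] at hz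
    simp only [Set.mem_ofPred_eq, inner_add_right, real_inner_smul_right, hub H hH] at hz
    by_contra hn
    nlinarith
  · intro hpos
    refine ⟨u H, fun h0 => ?_, hu H hH, fun y hy => ?_, fun y hy => ?_⟩
    · simp [h0] at hpos
    · exact (pos_iff_pos_of_mul_pos (mem_openCell.1 hy H hH)).1 hpos
    · have := mem_openCell.1 hy H hH
      rw [hub H hH] at this
      linarith

/-- If `y ∈ H` lies strictly on the side of `b` for all other hyperplanes of `P`, then `H` is
basic in `P`. -/
theorem isBasicIn_of_forall_neg {A P : Set (Set (EuclideanSpace ℝ (Fin n)))} (hA : A.Finite)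
    (hPA : P ⊆ A) {u : Set (EuclideanSpace ℝ (Fin n)) → EuclideanSpace ℝ (Fin n)}
    (hu : ∀ H ∈ A, H = {z | ⟪u H, z⟫ = 0}) {b y : EuclideanSpace ℝ (Fin n)}
    (hub : ∀ H ∈ A, ⟪u H, b⟫ = -1) (hb : b ∈ arrComplement A)
    {H : Set (EuclideanSpace ℝ (Fin n))} (hH : H ∈ P) (hy : y ∈ H)
    (hneg : ∀ K ∈ P, K ≠ H → ⟪u K, y⟫ < 0) :
    IsBasicIn P (closure (connectedComponentIn (arrComplement A) b)) H := by
  have hsub : arrComplement A ⊆ arrComplement P := fun x hx =>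
    mem_arrComplement.2 fun K hK => mem_arrComplement.1 hx K (hPA hK)
  have huP : ∀ K ∈ P, K = {z | ⟪u K, z⟫ = 0} := fun K hK => hu K (hPA hK)
  have hmem : ∀ z ∈ H, (∀ K ∈ P, K ≠ H → ⟪u K, z⟫ < 0) →
      z ∈ closure (connectedComponentIn (arrComplement P) b) := by
    intro z hz hzneg
    refine closure_mono (openCell_subset_connectedComponentIn huP (hsub hb)) ?_
    have hlim : Filter.Tendsto (fun t : ℝ => z + t • b) (nhdsWithin 0 (Set.Ioi 0)) (nhds z) := by
      have : Filter.Tendsto (fun t : ℝ => z + t • b) (nhds 0) (nhds (z + (0 : ℝ) • b)) :=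
        Continuous.tendsto (by fun_prop) _
      rw [zero_smul, add_zero] at this
      exact this.mono_left nhdsWithin_le_nhds
    refine mem_closure_of_tendsto hlim ?_
    filter_upwards [self_mem_nhdsWithin] with t (ht : 0 < t)
    refine mem_openCell.2 fun K hK => ?_
    rw [hub K (hPA hK), inner_add_right, real_inner_smul_right, hub K (hPA hK)]
    have : ⟪u K, z⟫ ≤ 0 := by
      by_cases hKH : K = H
      · subst hKH
        rw [huP K hK] at hz
        exact le_of_eq hz
      · exact (hzneg K hK hKH).le
    linarith
  refine ⟨hH, _, ⟨b, hsub hb, rfl⟩, closure_mono (connectedComponentIn_mono b hsub), ?_⟩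
  refine le_antisymm (Submodule.span_mono Set.inter_subset_left) (Submodule.span_le.2 ?_)
  intro h hh
  have hy0 : ⟪u H, y⟫ = 0 := by rw [huP H hH] at hy; exact hy
  have hh0 : ⟪u H, h⟫ = 0 := by rw [huP H hH] at hh; exact hh
  have hev : ∀ᶠ t : ℝ in nhdsWithin 0 (Set.Ioi 0), ∀ K ∈ P, K ≠ H → ⟪u K, y + t • h⟫ < 0 := by
    refine ((hA.subset hPA).eventually_all).2 fun K hK => ?_
    by_cases hKH : K = H
    · simp [hKH]
    · have hc : Filter.Tendsto (fun t : ℝ => ⟪u K, y + t • h⟫) (nhds 0)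
          (nhds ⟪u K, y + (0 : ℝ) • h⟫) := Continuous.tendsto (by fun_prop) _
      rw [zero_smul, add_zero] at hc
      filter_upwards [nhdsWithin_le_nhds (hc.eventually_lt_const (hneg K hK hKH))] with t ht _
      exact ht
  obtain ⟨t, ht, ht0⟩ := (hev.and self_mem_nhdsWithin).exists
  have ht0 : 0 < t := ht0
  have hyh : y + t • h ∈ H := by
    rw [huP H hH]
    simp [inner_add_right, real_inner_smul_right, hy0, hh0]
  have h1 := Submodule.subset_span (R := ℝ) (Set.mem_inter hyh (hmem _ hyh ht))
  have h2 := Submodule.subset_span (R := ℝ) (Set.mem_inter hy (hmem _ hy hneg))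
  have h3 := Submodule.smul_mem _ t⁻¹ (Submodule.sub_mem _ h1 h2)
  rwa [add_sub_cancel_left, smul_smul, inv_mul_cancel₀ ht0.ne', one_smul] at h3

/-- Among the hyperplanes positive on `x₁` and negative on `x₂`, one with largest normalized value
at `x₁` has a basic edge to every hyperplane negative on `x₁` and positive on `x₂`. -/
theorem basicEdge_of_maximal {A : Set (Set (EuclideanSpace ℝ (Fin n)))} (hA : A.Finite)
    {u : Set (EuclideanSpace ℝ (Fin n)) → EuclideanSpace ℝ (Fin n)}
    (hu : ∀ H ∈ A, H = {z | ⟪u H, z⟫ = 0}) {b x₁ x₂ : EuclideanSpace ℝ (Fin n)}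
    (hub : ∀ H ∈ A, ⟪u H, b⟫ = -1) (hb : b ∈ arrComplement A)
    {H H' : Set (EuclideanSpace ℝ (Fin n))} (hH : H ∈ A) (hH' : H' ∈ A)
    (h₁ : 0 < ⟪u H, x₁⟫) (h₂ : ⟪u H, x₂⟫ < 0) (h₁' : ⟪u H', x₁⟫ < 0) (h₂' : 0 < ⟪u H', x₂⟫)
    (hmax : ∀ K ∈ A, 0 < ⟪u K, x₁⟫ → ⟪u K, x₂⟫ < 0 → ⟪u K, x₁⟫ ≤ ⟪u H, x₁⟫) :
    BasicEdge A (closure (connectedComponentIn (arrComplement A) b)) H H' := by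
  refine ⟨hH, hH', ?_, ?_⟩
  · rintro rfl
    exact lt_asymm h₁ h₁'
  set y := x₁ + ⟪u H, x₁⟫ • b with hy
  have hyK : ∀ K ∈ A, ⟪u K, y⟫ = ⟪u K, x₁⟫ - ⟪u H, x₁⟫ := fun K hK => by
    rw [hy, inner_add_right, real_inner_smul_right, hub K hK]
    ring
  have hyH : ⟪u H, y⟫ = 0 := by rw [hyK H hH, sub_self]
  have hyH' : ⟪u H', y⟫ < 0 := by rw [hyK H' hH']; linarith
  refine isBasicIn_of_forall_neg (y := y) hA (fun K hK => hK.1) hu hub hb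
    ⟨hH, Set.inter_subset_left⟩ (by rw [hu H hH]; exact hyH) ?_
  rintro K ⟨hK, hKsub⟩ hne
  have hlin : ∀ x, ⟪u K, x⟫ = ⟪u H, x⟫ + ⟪u K, y⟫ / ⟪u H', y⟫ * (⟪u H', x⟫ - ⟪u H, x⟫) := by
    intro x
    have hz : x + ⟪u H, x⟫ • b - ((⟪u H', x⟫ - ⟪u H, x⟫) / ⟪u H', y⟫) • y ∈ K := by
      refine hKsub ⟨?_, ?_⟩
      · refine (Set.ext_iff.1 (hu H hH) _).2 ?_
        simp [inner_add_right, inner_sub_right, real_inner_smul_right, hub H hH, hyH]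
      · refine (Set.ext_iff.1 (hu H' hH') _).2 ?_
        simp only [Set.mem_ofPred_eq, inner_add_right, inner_sub_right, real_inner_smul_right,
          hub H' hH']
        rw [div_mul_cancel₀ _ hyH'.ne]
        ring
    rw [hu K hK] at hz
    simp only [Set.mem_ofPred_eq, inner_add_right, inner_sub_right, real_inner_smul_right,
      hub K hK] at hz
    linear_combination hz
  rcases lt_trichotomy ⟪u K, y⟫ 0 with h | h | h
  · exact h
  · refine absurd ?_ hne
    rw [hu K hK, hu H hH]
    ext x
    rw [Set.mem_ofPred_eq, Set.mem_ofPred_eq, hlin x, h]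
    simp
  · exfalso
    have hx₁ : ⟪u H, x₁⟫ < ⟪u K, x₁⟫ := by
      rw [hyK K hK] at h
      linarith
    have hx₂ : ⟪u K, x₂⟫ < 0 := by
      rw [hlin x₂]
      have := mul_neg_of_neg_of_pos (div_neg_of_pos_of_neg h hyH') (sub_pos.2 (h₂.trans h₂'))
      linarith
    exact absurd (hmax K hK (h₁.trans hx₁) hx₂) (not_le.2 hx₁)

/-- **Theorem (Reading, Theorem 2).** For a central hyperplane arrangement `A` with base
region `B`, if `A = I₁ ∪ ⋯ ∪ I_k` is a partition such that each part induces an acyclic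
sub-digraph of the basic digraph 𝒟(𝒜,B), then the order dimension of the poset of regions
𝒫(𝒜,B) is at most `k`. -/
theorem orderDim_le_of_acyclic_covering {n k : ℕ}
    (A : Set (Set (EuclideanSpace ℝ (Fin n)))) (B : Set (EuclideanSpace ℝ (Fin n)))
    (hA : IsCentralArrangement A) (hB : IsRegion A B)
    (I : Fin k → Set (Set (EuclideanSpace ℝ (Fin n))))
    (hcover : A = ⋃ j, I j)
    (hdisj : ∀ j j' : Fin k, j ≠ j' → Disjoint (I j) (I j'))
    (hacyclic : ∀ j : Fin k, ∀ H,
      ¬ Relation.TransGen (fun H₁ H₂ => H₁ ∈ I j ∧ H₂ ∈ I j ∧ BasicEdge A B H₁ H₂) H H) :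
    regionOrderDim A B ≤ k := by
  classical
  obtain ⟨b, hb, rfl⟩ := hB
  obtain ⟨hfin, -, hhyp⟩ := hA
  have hex : ∀ H, ∃ v : EuclideanSpace ℝ (Fin n),
      H ∈ A → H = {x | ⟪v, x⟫ = 0} ∧ ⟪v, b⟫ = -1 := fun H => by
    by_cases hH : H ∈ A
    · obtain ⟨v, hv⟩ := (hhyp H hH).exists_normalized (mem_arrComplement.1 hb H hH)
      exact ⟨v, fun _ => hv⟩
    · exact ⟨0, fun h => absurd h hH⟩
  choose u hu' using hex
  have hu : ∀ H ∈ A, H = {x | ⟪u H, x⟫ = 0} := fun H hH => (hu' H hH).1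
  have hub : ∀ H ∈ A, ⟪u H, b⟫ = -1 := fun H hH => (hu' H hH).2
  set B := closure (connectedComponentIn (arrComplement A) b)
  have : Fintype A := hfin.fintype
  have hw : ∀ j, ∃ w : A → ℝ, (∀ a, 0 < w a) ∧ ∀ a (s : Finset A),
      (∀ b ∈ s, a.1 ∈ I j ∧ b.1 ∈ I j ∧ BasicEdge A B a.1 b.1) → ∑ b ∈ s, w b < w a := fun j =>
    exists_weight_of_acyclic _ fun a ha =>
      hacyclic j a.1 (Relation.TransGen.lift Subtype.val (fun _ _ h => h) _ _ ha)
  choose w hwpos hwsum using hw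
  let T : Set (EuclideanSpace ℝ (Fin n)) → Fin k → Finset A := fun R j =>
    Finset.univ.filter fun H => H.1 ∈ I j ∧ H.1 ∈ sepSet A B R
  have hT : ∀ R j (H : A), H ∈ T R j ↔ H.1 ∈ I j ∧ H.1 ∈ sepSet A B R := by simp [T]
  refine Nat.sInf_le ⟨fun R j => ∑ H ∈ T R.1 j, w j H, ?_⟩
  rintro ⟨R₁, hR₁⟩ ⟨R₂, hR₂⟩
  constructor
  · intro hle j
    refine Finset.sum_le_sum_of_subset_of_nonneg (fun H hH => ?_) fun H _ _ => (hwpos j H).le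
    rw [hT] at hH ⊢
    exact ⟨hH.1, hle hH.2⟩
  · intro hle
    by_contra hnot
    obtain ⟨x₁, hx₁, rfl⟩ := hR₁
    obtain ⟨x₂, hx₂, rfl⟩ := hR₂
    have hs₁ := fun H (hH : H ∈ A) => mem_sepSet_iff hfin hu hub hb hx₁ hH
    have hs₂ := fun H (hH : H ∈ A) => mem_sepSet_iff hfin hu hub hb hx₂ hH
    have hneg : ∀ x ∈ arrComplement A, ∀ H ∈ A, ¬ 0 < ⟪u H, x⟫ → ⟪u H, x⟫ < 0 :=
      fun x hx H hH h => lt_of_le_of_ne (not_lt.1 h) fun h0 =>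
        mem_arrComplement.1 hx H hH (by rw [hu H hH]; exact h0)
    obtain ⟨H₀, hH₀, hH₀'⟩ := Set.not_subset.1 hnot
    obtain ⟨H, ⟨hH, hH₁, hH₂⟩, hmax⟩ := Set.exists_max_image
      {H | H ∈ A ∧ 0 < ⟪u H, x₁⟫ ∧ ⟪u H, x₂⟫ < 0} (fun H => ⟪u H, x₁⟫)
      (hfin.subset fun H hH => hH.1)
      ⟨H₀, hH₀.1, (hs₁ H₀ hH₀.1).1 hH₀,
        hneg x₂ hx₂ H₀ hH₀.1 fun h => hH₀' ((hs₂ H₀ hH₀.1).2 h)⟩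
    obtain ⟨j, hj⟩ := Set.mem_iUnion.1 (hcover ▸ hH)
    refine absurd (hle j) (not_le.2 ?_)
    set T₁ := T (closure (connectedComponentIn (arrComplement A) x₁)) j
    set T₂ := T (closure (connectedComponentIn (arrComplement A) x₂)) j
    have hlt : ∑ K ∈ T₂ \ T₁, w j K < w j ⟨H, hH⟩ := by
      refine hwsum j ⟨H, hH⟩ _ fun K hK => ?_
      rw [Finset.mem_sdiff, hT, hT, hs₁ K K.2, hs₂ K K.2] at hK
      obtain ⟨⟨hKj, hK₂⟩, hK₁⟩ := hK
      exact ⟨hj, hKj, basicEdge_of_maximal hfin hu hub hb hH K.2 hH₁ hH₂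
        (hneg x₁ hx₁ K K.2 fun h => hK₁ ⟨hKj, h⟩) hK₂
        fun L hL h₁ h₂ => hmax L ⟨hL, h₁, h₂⟩⟩
    have hge : w j ⟨H, hH⟩ ≤ ∑ K ∈ T₁ \ T₂, w j K := by
      refine Finset.single_le_sum (fun K _ => (hwpos j K).le) ?_
      rw [Finset.mem_sdiff, hT, hT, hs₁ H hH, hs₂ H hH]
      exact ⟨⟨hj, hH₁⟩, fun h => lt_asymm hH₂ h.2⟩
    have e₁ := Finset.sum_inter_add_sum_sdiff T₁ T₂ (w j)
    have e₂ := Finset.sum_inter_add_sum_sdiff T₂ T₁ (w j)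
    rw [Finset.inter_comm] at e₂
    linarith
end
end

section
/- Let 𝒜 be a central hyperplane arrangement in ℝⁿ with base region B. A pair (J,M) of regions is subcritical in 𝒫(𝒜,B) if and only if there is a shard Σ of (𝒜,B) such that J is minimal in U(Σ), M is maximal in L(Σ), and J_* ≤ M, where J_* is the unique region covered by J. -/
open scoped RealInnerProductSpace

noncomputable section

variable {n : ℕ}

/-- The hyperplane `H` with the cutting loci removed: for each rank-two subarrangement
containing `H` in which `H` is not basic, the codimension-two intersection is removed. -/
def shardCut (A : Set (Set (EuclideanSpace ℝ (Fin n)))) (B H : Set (EuclideanSpace ℝ (Fin n))) :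
    Set (EuclideanSpace ℝ (Fin n)) :=
  H \ ⋃ H' ∈ {H' | H' ∈ A ∧ H' ≠ H ∧ ¬ IsBasicIn (pencil A H H') B H}, (H ∩ H')

/-- `Sg` is a shard of `(A,B)` contained in the hyperplane `H`: a connected component of `H`
with the cutting loci removed. -/
def IsShardOf (A : Set (Set (EuclideanSpace ℝ (Fin n))))
    (B H Sg : Set (EuclideanSpace ℝ (Fin n))) : Prop :=
  H ∈ A ∧ ∃ x ∈ shardCut A B H, Sg = connectedComponentIn (shardCut A B H) x

/-- U(Σ): the regions meeting the shard `Sg` in codimension one whose separating set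
contains the hyperplane `H` containing `Sg`. -/
def upperRegions (A : Set (Set (EuclideanSpace ℝ (Fin n))))
    (B H Sg : Set (EuclideanSpace ℝ (Fin n))) : Set (Set (EuclideanSpace ℝ (Fin n))) :=
  {R | IsRegion A R ∧ Submodule.span ℝ (R ∩ Sg) = Submodule.span ℝ H ∧ H ∈ sepSet A B R}

/-- L(Σ): the regions meeting the shard `Sg` in codimension one whose separating set
does not contain the hyperplane `H` containing `Sg`. -/
def lowerRegions (A : Set (Set (EuclideanSpace ℝ (Fin n))))
    (B H Sg : Set (EuclideanSpace ℝ (Fin n))) : Set (Set (EuclideanSpace ℝ (Fin n))) :=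
  {R | IsRegion A R ∧ Submodule.span ℝ (R ∩ Sg) = Submodule.span ℝ H ∧ H ∉ sepSet A B R}

/-- `J` is a minimal element of U(Σ), as a subposet of 𝒫(𝒜,B). -/
def MinimalInU (A : Set (Set (EuclideanSpace ℝ (Fin n))))
    (B H Sg J : Set (EuclideanSpace ℝ (Fin n))) : Prop :=
  J ∈ upperRegions A B H Sg ∧
    ∀ R ∈ upperRegions A B H Sg, regLE A B R J → regLE A B J R

/-- `M` is a maximal element of L(Σ), as a subposet of 𝒫(𝒜,B). -/
def MaximalInL (A : Set (Set (EuclideanSpace ℝ (Fin n))))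
    (B H Sg M : Set (EuclideanSpace ℝ (Fin n))) : Prop :=
  M ∈ lowerRegions A B H Sg ∧
    ∀ R ∈ lowerRegions A B H Sg, regLE A B M R → regLE A B R M

/-- `J` covers `Jst` in the poset of regions 𝒫(𝒜,B). -/
def CoversReg (A : Set (Set (EuclideanSpace ℝ (Fin n))))
    (B J Jst : Set (EuclideanSpace ℝ (Fin n))) : Prop :=
  IsRegion A Jst ∧ regLT A B Jst J ∧
    ∀ R, IsRegion A R → regLT A B Jst R → regLT A B R J → False

/-- `R` is an upper bound of the set `X` of regions in 𝒫(𝒜,B). -/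
def regIsUB (A : Set (Set (EuclideanSpace ℝ (Fin n)))) (B : Set (EuclideanSpace ℝ (Fin n)))
    (X : Set (Set (EuclideanSpace ℝ (Fin n)))) (R : Set (EuclideanSpace ℝ (Fin n))) : Prop :=
  ∀ R' ∈ X, regLE A B R' R

/-- `R` is the least upper bound of the set `X` of regions in 𝒫(𝒜,B). -/
def regIsLUB (A : Set (Set (EuclideanSpace ℝ (Fin n)))) (B : Set (EuclideanSpace ℝ (Fin n)))
    (X : Set (Set (EuclideanSpace ℝ (Fin n)))) (R : Set (EuclideanSpace ℝ (Fin n))) : Prop :=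
  regIsUB A B X R ∧ ∀ R', IsRegion A R' → regIsUB A B X R' → regLE A B R R'

/-- `R` is a lower bound of the set `X` of regions in 𝒫(𝒜,B). -/
def regIsLB (A : Set (Set (EuclideanSpace ℝ (Fin n)))) (B : Set (EuclideanSpace ℝ (Fin n)))
    (X : Set (Set (EuclideanSpace ℝ (Fin n)))) (R : Set (EuclideanSpace ℝ (Fin n))) : Prop :=
  ∀ R' ∈ X, regLE A B R R'

/-- `R` is the greatest lower bound of the set `X` of regions in 𝒫(𝒜,B). -/
def regIsGLB (A : Set (Set (EuclideanSpace ℝ (Fin n)))) (B : Set (EuclideanSpace ℝ (Fin n)))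
    (X : Set (Set (EuclideanSpace ℝ (Fin n)))) (R : Set (EuclideanSpace ℝ (Fin n))) : Prop :=
  regIsLB A B X R ∧ ∀ R', IsRegion A R' → regIsLB A B X R' → regLE A B R' R

/-- `J` is join-irreducible in 𝒫(𝒜,B): there is no set `X` of regions with `J ∉ X`
whose least upper bound is `J`. -/
def JoinIrredReg (A : Set (Set (EuclideanSpace ℝ (Fin n))))
    (B J : Set (EuclideanSpace ℝ (Fin n))) : Prop :=
  IsRegion A J ∧ ¬ ∃ X : Set (Set (EuclideanSpace ℝ (Fin n))),
    (∀ R ∈ X, IsRegion A R) ∧ J ∉ X ∧ regIsLUB A B X J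

/-- `M` is meet-irreducible in 𝒫(𝒜,B): there is no set `X` of regions with `M ∉ X`
whose greatest lower bound is `M`. -/
def MeetIrredReg (A : Set (Set (EuclideanSpace ℝ (Fin n))))
    (B M : Set (EuclideanSpace ℝ (Fin n))) : Prop :=
  IsRegion A M ∧ ¬ ∃ X : Set (Set (EuclideanSpace ℝ (Fin n))),
    (∀ R ∈ X, IsRegion A R) ∧ M ∉ X ∧ regIsGLB A B X M

/-- `(J,M)` is a subcritical pair in the poset of regions 𝒫(𝒜,B). -/
def SubcritReg (A : Set (Set (EuclideanSpace ℝ (Fin n))))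
    (B J M : Set (EuclideanSpace ℝ (Fin n))) : Prop :=
  IsRegion A J ∧ IsRegion A M ∧ ¬ regLE A B J M ∧
    (∀ X, IsRegion A X → regLT A B X J → regLE A B X M) ∧
    (∀ X, IsRegion A X → regLT A B M X → regLE A B J X)

/-- `ν` chooses for every hyperplane of `A` a normal vector on which `b` is negative. -/
structure IsNormalSystem (A : Set (Set (EuclideanSpace ℝ (Fin n)))) (b : EuclideanSpace ℝ (Fin n))
    (ν : Set (EuclideanSpace ℝ (Fin n)) → EuclideanSpace ℝ (Fin n)) : Prop where
  finite : A.Finite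
  mem_iff : ∀ K ∈ A, ∀ x, x ∈ K ↔ ⟪ν K, x⟫ = 0
  neg : ∀ K ∈ A, ⟪ν K, b⟫ < 0

/-- The point `x` lies on no hyperplane of `A`. -/
def IsGeneric (A : Set (Set (EuclideanSpace ℝ (Fin n))))
    (ν : Set (EuclideanSpace ℝ (Fin n)) → EuclideanSpace ℝ (Fin n))
    (x : EuclideanSpace ℝ (Fin n)) : Prop :=
  ∀ K ∈ A, ⟪ν K, x⟫ ≠ 0

/-- The points of `C` lying strictly on the same side as `x` of every hyperplane of `A`. -/
def cell (A : Set (Set (EuclideanSpace ℝ (Fin n))))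
    (ν : Set (EuclideanSpace ℝ (Fin n)) → EuclideanSpace ℝ (Fin n))
    (C : Set (EuclideanSpace ℝ (Fin n))) (x : EuclideanSpace ℝ (Fin n)) :
    Set (EuclideanSpace ℝ (Fin n)) :=
  {y | y ∈ C ∧ ∀ K ∈ A, 0 < ⟪ν K, x⟫ * ⟪ν K, y⟫}

/-- The closed region of the arrangement `A` containing the generic point `x`. -/
abbrev region (A : Set (Set (EuclideanSpace ℝ (Fin n))))
    (ν : Set (EuclideanSpace ℝ (Fin n)) → EuclideanSpace ℝ (Fin n))
    (x : EuclideanSpace ℝ (Fin n)) : Set (EuclideanSpace ℝ (Fin n)) :=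
  closure (cell A ν Set.univ x)

section Cells

variable {A : Set (Set (EuclideanSpace ℝ (Fin n)))}
  {ν : Set (EuclideanSpace ℝ (Fin n)) → EuclideanSpace ℝ (Fin n)}

theorem mul_pos_trans {r s t : ℝ} (h₁ : 0 < r * s) (h₂ : 0 < s * t) : 0 < r * t := by
  have hs : 0 < s * s := mul_self_pos.2 (left_ne_zero_of_mul h₂.ne')
  nlinarith [mul_pos h₁ h₂]

theorem inner_smul_add_smul (v x y : EuclideanSpace ℝ (Fin n)) (s t : ℝ) :
    ⟪v, s • x + t • y⟫ = s * ⟪v, x⟫ + t * ⟪v, y⟫ := by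
  rw [inner_add_right, real_inner_smul_right, real_inner_smul_right]

theorem inner_add_smul (v x y : EuclideanSpace ℝ (Fin n)) (t : ℝ) :
    ⟪v, x + t • y⟫ = ⟪v, x⟫ + t * ⟪v, y⟫ := by
  rw [inner_add_right, real_inner_smul_right]

theorem convex_cell {C : Set (EuclideanSpace ℝ (Fin n))} (hC : Convex ℝ C)
    (x : EuclideanSpace ℝ (Fin n)) : Convex ℝ (cell A ν C x) := by
  rintro y ⟨hy, hy'⟩ z ⟨hz, hz'⟩ s t hs ht hst
  refine ⟨hC hy hz hs ht hst, fun K hK => ?_⟩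
  rw [inner_smul_add_smul]
  have h1 := hy' K hK
  have h2 := hz' K hK
  rcases hs.eq_or_lt with rfl | hs
  · obtain rfl : t = 1 := by linarith
    simpa using h2
  · nlinarith [mul_pos hs h1, mul_nonneg ht h2.le]

theorem connectedComponentIn_eq_cell {C : Set (EuclideanSpace ℝ (Fin n))} (hC : Convex ℝ C)
    {x : EuclideanSpace ℝ (Fin n)} (hx : x ∈ C) (hxA : IsGeneric A ν x) :
    connectedComponentIn {y | y ∈ C ∧ IsGeneric A ν y} x = cell A ν C x := by
  apply Set.Subset.antisymm
  · intro y hy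
    have hsub := connectedComponentIn_subset {y | y ∈ C ∧ IsGeneric A ν y} x
    refine ⟨(hsub hy).1, fun K hK => ?_⟩
    by_contra hneg
    have hmem : (0 : ℝ) ∈ Set.uIcc ⟪ν K, x⟫ ⟪ν K, y⟫ := by
      rw [Set.mem_uIcc]
      rcases le_total 0 ⟪ν K, x⟫ with h | h <;> rcases le_total 0 ⟪ν K, y⟫ with h' | h'
      · have h1 := lt_of_le_of_ne h (hxA K hK).symm
        have h2 := lt_of_le_of_ne h' ((hsub hy).2 K hK).symm
        exact absurd (mul_pos h1 h2) hneg
      · exact Or.inr ⟨h', h⟩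
      · exact Or.inl ⟨h, h'⟩
      · have h1 := lt_of_le_of_ne h (hxA K hK)
        have h2 := lt_of_le_of_ne h' ((hsub hy).2 K hK)
        exact absurd (mul_pos_of_neg_of_neg h1 h2) hneg
    have himg : IsPreconnected ((fun z => ⟪ν K, z⟫) ''
        connectedComponentIn {y | y ∈ C ∧ IsGeneric A ν y} x) :=
      isPreconnected_connectedComponentIn.image _ (by fun_prop)
    obtain ⟨z, hz, hz0⟩ := himg.ordConnected.uIcc_subset
      ⟨x, mem_connectedComponentIn ⟨hx, hxA⟩, rfl⟩ ⟨y, hy, rfl⟩ hmem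
    exact (hsub hz).2 K hK hz0
  · refine (convex_cell hC x).isPreconnected.subset_connectedComponentIn
      ⟨hx, fun K hK => mul_self_pos.2 (hxA K hK)⟩ ?_
    rintro y ⟨hy, hy'⟩
    exact ⟨hy, fun K hK => right_ne_zero_of_mul (hy' K hK).ne'⟩

/-- Moving slightly from `q` in the direction `p` preserves all strict signs at `q`. -/
theorem exists_pos_perturb {F : Set (Set (EuclideanSpace ℝ (Fin n)))} (hF : F.Finite)
    (q p : EuclideanSpace ℝ (Fin n)) :
    ∃ ε : ℝ, 0 < ε ∧ ∀ K ∈ F, (0 < ⟪ν K, q⟫ → 0 < ⟪ν K, q + ε • p⟫) ∧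
      (⟪ν K, q⟫ < 0 → ⟪ν K, q + ε • p⟫ < 0) := by
  have key : ∀ᶠ ε in nhdsWithin (0 : ℝ) (Set.Ioi 0), ∀ K ∈ F,
      (0 < ⟪ν K, q⟫ → 0 < ⟪ν K, q + ε • p⟫) ∧
      (⟪ν K, q⟫ < 0 → ⟪ν K, q + ε • p⟫ < 0) := by
    refine (Filter.eventually_all_finite hF).2 fun K _ => ?_
    have hc : Filter.Tendsto (fun ε : ℝ => ⟪ν K, q + ε • p⟫) (nhdsWithin 0 (Set.Ioi 0))
        (nhds ⟪ν K, q⟫) := by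
      have : Continuous fun ε : ℝ => ⟪ν K, q + ε • p⟫ := by fun_prop
      simpa using (this.tendsto 0).mono_left nhdsWithin_le_nhds
    rcases lt_trichotomy 0 ⟪ν K, q⟫ with h | h | h
    · filter_upwards [hc.eventually (lt_mem_nhds h)] with ε hε
      exact ⟨fun _ => hε, fun h' => absurd h' h.not_gt⟩
    · exact Filter.Eventually.of_forall fun ε =>
        ⟨fun h' => absurd h h'.ne, fun h' => absurd h h'.ne'⟩
    · filter_upwards [hc.eventually (gt_mem_nhds h)] with ε hε
      exact ⟨fun h' => absurd h' h.not_gt, fun _ => hε⟩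
  obtain ⟨ε, h, hε⟩ := (key.and self_mem_nhdsWithin).exists
  exact ⟨ε, hε, h⟩

/-- Perturbing `q` in a generic direction `p` yields a generic point with the same
strict signs as `q`. -/
theorem exists_perturb {F : Set (Set (EuclideanSpace ℝ (Fin n)))} (hF : F.Finite)
    (q : EuclideanSpace ℝ (Fin n)) {p : EuclideanSpace ℝ (Fin n)} (hp : IsGeneric F ν p) :
    ∃ ε : ℝ, 0 < ε ∧ IsGeneric F ν (q + ε • p) ∧
      ∀ K ∈ F, (0 < ⟪ν K, q⟫ → 0 < ⟪ν K, q + ε • p⟫) ∧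
      (⟪ν K, q⟫ < 0 → ⟪ν K, q + ε • p⟫ < 0) := by
  obtain ⟨ε, hε, h⟩ := exists_pos_perturb (ν := ν) hF q p
  refine ⟨ε, hε, fun K hK => ?_, h⟩
  rcases lt_trichotomy 0 ⟪ν K, q⟫ with h' | h' | h'
  · exact ((h K hK).1 h').ne'
  · rw [inner_add_smul, ← h', zero_add]
    exact mul_ne_zero hε.ne' (hp K hK)
  · exact ((h K hK).2 h').ne

/-- The points of a hyperplane near a given one span it. -/
theorem span_eq_of_nearby {F : Set (Set (EuclideanSpace ℝ (Fin n)))} (hF : F.Finite)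
    {v : EuclideanSpace ℝ (Fin n)} {H T : Set (EuclideanSpace ℝ (Fin n))}
    (hH : ∀ x, x ∈ H ↔ ⟪v, x⟫ = 0) {p : EuclideanSpace ℝ (Fin n)} (hpH : p ∈ H)
    (hp : IsGeneric F ν p) (hTH : T ⊆ H) (hT : cell F ν H p ⊆ T) :
    Submodule.span ℝ T = Submodule.span ℝ H := by
  refine le_antisymm (Submodule.span_mono hTH) (Submodule.span_le.2 fun w hw => ?_)
  obtain ⟨ε, hε, h⟩ := exists_pos_perturb (ν := ν) hF p w
  have h1 : p ∈ T := hT ⟨hpH, fun K hK => mul_self_pos.2 (hp K hK)⟩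
  have h2 : p + ε • w ∈ T := by
    refine hT ⟨?_, fun K hK => ?_⟩
    · rw [hH, inner_add_smul, (hH p).1 hpH, (hH w).1 hw]; simp
    · rcases (hp K hK).lt_or_gt with h' | h'
      · exact mul_pos_of_neg_of_neg h' ((h K hK).2 h')
      · exact mul_pos h' ((h K hK).1 h')
  have h3 := Submodule.smul_mem _ ε⁻¹
    (Submodule.sub_mem _ (Submodule.subset_span h2) (Submodule.subset_span (R := ℝ) h1))
  simpa [smul_smul, inv_mul_cancel₀ hε.ne'] using h3

end Cells

namespace IsNormalSystem

variable {A : Set (Set (EuclideanSpace ℝ (Fin n)))} {b : EuclideanSpace ℝ (Fin n)}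
  {ν : Set (EuclideanSpace ℝ (Fin n)) → EuclideanSpace ℝ (Fin n)}

theorem mono (N : IsNormalSystem A b ν) {A' : Set (Set (EuclideanSpace ℝ (Fin n)))}
    (h : A' ⊆ A) : IsNormalSystem A' b ν :=
  ⟨N.finite.subset h, fun K hK => N.mem_iff K (h hK), fun K hK => N.neg K (h hK)⟩

theorem isGeneric_base (N : IsNormalSystem A b ν) : IsGeneric A ν b :=
  fun K hK => (N.neg K hK).ne

theorem arrComplement_eq (N : IsNormalSystem A b ν) :
    arrComplement A = {y | y ∈ Set.univ ∧ IsGeneric A ν y} := by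
  ext x
  simp only [arrComplement, Set.mem_compl_iff, Set.mem_iUnion, not_exists, Set.mem_ofPred_eq,
    Set.mem_univ, true_and, IsGeneric]
  exact forall₂_congr fun K hK => (N.mem_iff K hK x).not

theorem isRegion_iff (N : IsNormalSystem A b ν) {R : Set (EuclideanSpace ℝ (Fin n))} :
    IsRegion A R ↔ ∃ x, IsGeneric A ν x ∧ R = region A ν x := by
  rw [IsRegion, N.arrComplement_eq]
  refine exists_congr fun x => ?_
  simp only [Set.mem_ofPred_eq, Set.mem_univ, true_and]
  refine and_congr_right fun hx => ?_
  have := connectedComponentIn_eq_cell convex_univ (Set.mem_univ x) hx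
  simp only [Set.mem_univ, true_and] at this
  rw [this]

theorem mem_region {x y : EuclideanSpace ℝ (Fin n)} (hx : IsGeneric A ν x) :
    y ∈ region A ν x ↔ ∀ K ∈ A, 0 ≤ ⟪ν K, x⟫ * ⟪ν K, y⟫ := by
  constructor
  · intro hy K hK
    have hcl : IsClosed {z | 0 ≤ ⟪ν K, x⟫ * ⟪ν K, z⟫} :=
      isClosed_le continuous_const (by fun_prop)
    exact closure_minimal (fun z hz => (hz.2 K hK).le) hcl hy
  · intro hy
    have hc : Filter.Tendsto (fun ε : ℝ => y + ε • x) (nhdsWithin 0 (Set.Ioi 0)) (nhds y) := by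
      have : Continuous fun ε : ℝ => y + ε • x := by fun_prop
      simpa using (this.tendsto 0).mono_left nhdsWithin_le_nhds
    refine mem_closure_of_tendsto hc ?_
    filter_upwards [self_mem_nhdsWithin] with ε hε
    refine ⟨Set.mem_univ _, fun K hK => ?_⟩
    rw [inner_add_smul]
    nlinarith [hy K hK, mul_pos (Set.mem_Ioi.1 hε) (mul_self_pos.2 (hx K hK))]

theorem isOpen_cell (N : IsNormalSystem A b ν) (x : EuclideanSpace ℝ (Fin n)) :
    IsOpen (cell A ν Set.univ x) := by
  have : cell A ν Set.univ x = ⋂ K ∈ A, {y | 0 < ⟪ν K, x⟫ * ⟪ν K, y⟫} := by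
    ext y; simp [cell]
  rw [this]
  exact N.finite.isOpen_biInter fun K _ => isOpen_lt continuous_const (by fun_prop)

theorem mem_cell {x : EuclideanSpace ℝ (Fin n)} (hx : IsGeneric A ν x) :
    x ∈ cell A ν Set.univ x :=
  ⟨Set.mem_univ _, fun K hK => mul_self_pos.2 (hx K hK)⟩

theorem interior_region (N : IsNormalSystem A b ν) {x : EuclideanSpace ℝ (Fin n)}
    (hx : IsGeneric A ν x) :
    interior (region A ν x) = cell A ν Set.univ x := by
  rw [(convex_cell convex_univ x).interior_closure_eq_interior_of_nonempty_interior,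
    (N.isOpen_cell x).interior_eq]
  rw [(N.isOpen_cell x).interior_eq]
  exact ⟨x, mem_cell hx⟩

theorem mem_sepSet (N : IsNormalSystem A b ν) {x : EuclideanSpace ℝ (Fin n)}
    (hx : IsGeneric A ν x) (K : Set (EuclideanSpace ℝ (Fin n))) :
    K ∈ sepSet A (region A ν b) (region A ν x) ↔
      K ∈ A ∧ 0 < ⟪ν K, x⟫ := by
  rw [sepSet, Set.mem_ofPred_eq]
  refine and_congr_right fun hK => ?_
  have hb := N.neg K hK
  rw [Separates, N.interior_region hx, N.interior_region N.isGeneric_base]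
  constructor
  · rintro ⟨v, -, hv, hvx, hvb⟩
    have h1 := hvx x (mem_cell hx)
    have h2 := hvb b (mem_cell N.isGeneric_base)
    have hz : ⟪v, x⟫ • b + (-⟪v, b⟫) • x ∈ K := by
      rw [hv, Set.mem_ofPred_eq, inner_smul_add_smul]; ring
    rw [N.mem_iff K hK, inner_smul_add_smul] at hz
    by_contra h3
    nlinarith [mul_pos h1 (neg_pos.2 hb), mul_nonneg (neg_pos.2 h2).le (neg_nonneg.2 (not_lt.1 h3))]
  · intro h
    refine ⟨ν K, fun h0 => by simp [h0] at h, Set.ext (N.mem_iff K hK), fun y hy => ?_,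
      fun y hy => ?_⟩
    · exact (pos_iff_pos_of_mul_pos (hy.2 K hK)).1 h
    · exact (neg_iff_neg_of_mul_pos (hy.2 K hK)).1 hb

theorem cell_congr (C : Set (EuclideanSpace ℝ (Fin n))) {x y : EuclideanSpace ℝ (Fin n)}
    (h : ∀ K ∈ A, 0 < ⟪ν K, x⟫ * ⟪ν K, y⟫) : cell A ν C x = cell A ν C y := by
  ext z
  refine and_congr_right fun _ => forall₂_congr fun K hK => ?_
  have hxy := h K hK
  exact ⟨fun hz => mul_pos_trans (mul_comm ⟪ν K, x⟫ ⟪ν K, y⟫ ▸ hxy) hz,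
    fun hz => mul_pos_trans hxy hz⟩

theorem inner_eq_zero_iff_of_proportional {u v y : EuclideanSpace ℝ (Fin n)}
    (hu : ⟪u, y⟫ ≠ 0) (hv : ⟪v, y⟫ ≠ 0) (h : ⟪v, y⟫ • u - ⟪u, y⟫ • v = 0)
    (x : EuclideanSpace ℝ (Fin n)) : ⟪u, x⟫ = 0 ↔ ⟪v, x⟫ = 0 := by
  have hx : ⟪v, y⟫ * ⟪u, x⟫ = ⟪u, y⟫ * ⟪v, x⟫ := by
    have := congrArg (fun w => ⟪w, x⟫) (sub_eq_zero.1 h)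
    simpa [real_inner_smul_left] using this
  constructor
  · intro h0
    simpa [h0, hu] using hx
  · intro h0
    simpa [h0, hv] using hx

theorem eq_of_subset (N : IsNormalSystem A b ν) {H K : Set (EuclideanSpace ℝ (Fin n))}
    (hH : H ∈ A) (hK : K ∈ A) (h : H ⊆ K) : H = K := by
  refine h.antisymm fun x hx => ?_
  have hmem : ⟪ν H, b⟫ • x + (-⟪ν H, x⟫) • b ∈ H := by
    rw [N.mem_iff H hH, inner_smul_add_smul]; ring
  have h0 := (N.mem_iff K hK _).1 (h hmem)
  rw [inner_smul_add_smul, (N.mem_iff K hK x).1 hx, mul_zero, zero_add, neg_mul,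
    neg_eq_zero] at h0
  rw [N.mem_iff H hH]
  exact (mul_eq_zero.1 h0).resolve_right (N.neg K hK).ne

theorem regLE_iff (N : IsNormalSystem A b ν) {x y : EuclideanSpace ℝ (Fin n)}
    (hx : IsGeneric A ν x) (hy : IsGeneric A ν y) :
    regLE A (region A ν b) (region A ν x) (region A ν y) ↔
      ∀ K ∈ A, 0 < ⟪ν K, x⟫ → 0 < ⟪ν K, y⟫ := by
  simp only [regLE, Set.subset_def, N.mem_sepSet hx, N.mem_sepSet hy]
  exact ⟨fun h K hK hKx => (h K ⟨hK, hKx⟩).2, fun h K hK => ⟨hK.1, h K hK.1 hK.2⟩⟩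

theorem regLT_of_regLE (N : IsNormalSystem A b ν) {x y : EuclideanSpace ℝ (Fin n)}
    (hx : IsGeneric A ν x) (hy : IsGeneric A ν y)
    (h : regLE A (region A ν b) (region A ν x) (region A ν y))
    {K : Set (EuclideanSpace ℝ (Fin n))} (hK : K ∈ A) (hKx : ⟪ν K, x⟫ < 0) (hKy : 0 < ⟪ν K, y⟫) :
    regLT A (region A ν b) (region A ν x) (region A ν y) :=
  ⟨h, fun h' => hKx.not_gt ((N.regLE_iff hy hx).1 h' K hK hKy)⟩

theorem region_eq_of_sepSet_eq (N : IsNormalSystem A b ν)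
    {R R' : Set (EuclideanSpace ℝ (Fin n))} (hR : IsRegion A R) (hR' : IsRegion A R')
    (h : sepSet A (region A ν b) R = sepSet A (region A ν b) R') : R = R' := by
  obtain ⟨x, hx, rfl⟩ := N.isRegion_iff.1 hR
  obtain ⟨y, hy, rfl⟩ := N.isRegion_iff.1 hR'
  have hxy := (N.regLE_iff hx hy).1 h.subset
  have hyx := (N.regLE_iff hy hx).1 h.superset
  refine congrArg closure (cell_congr _ fun K hK => ?_)
  rcases (hx K hK).lt_or_gt with h1 | h1
  · exact mul_pos_of_neg_of_neg h1
      ((hy K hK).lt_of_le (not_lt.1 fun h2 => h1.not_gt (hyx K hK h2)))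
  · exact mul_pos h1 (hxy K hK h1)

theorem exists_between_of_lt (N : IsNormalSystem A b ν) {x y : EuclideanSpace ℝ (Fin n)}
    (hy : IsGeneric A ν y) (hle : ∀ L ∈ A, 0 < ⟪ν L, x⟫ → 0 < ⟪ν L, y⟫)
    {K K' : Set (EuclideanSpace ℝ (Fin n))} (hK : K ∈ A) (hK' : K' ∈ A)
    (h : ⟪ν K, x⟫ * ⟪ν K', y⟫ < ⟪ν K', x⟫ * ⟪ν K, y⟫) (hx : IsGeneric A ν x)
    (hKx : ⟪ν K, x⟫ < 0) (hKx' : ⟪ν K', x⟫ < 0) (hKy : 0 < ⟪ν K, y⟫) (hKy' : 0 < ⟪ν K', y⟫) :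
    ∃ z, IsGeneric A ν z ∧ regLT A (region A ν b) (region A ν x) (region A ν z) ∧
      regLT A (region A ν b) (region A ν z) (region A ν y) := by
  set q := (⟪ν K, y⟫ + ⟪ν K', y⟫) • x + (-⟪ν K, x⟫ - ⟪ν K', x⟫) • y with hq
  have hs : 0 < ⟪ν K, y⟫ + ⟪ν K', y⟫ := by linarith
  have ht : 0 < -⟪ν K, x⟫ - ⟪ν K', x⟫ := by linarith
  obtain ⟨ε, -, hz, hsign⟩ := exists_perturb N.finite q hy
  refine ⟨_, hz, ?_, ?_⟩
  · refine N.regLT_of_regLE hx hz ((N.regLE_iff hx hz).2 fun L hL h1 => ?_) hK' hKx' ?_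
    · refine (hsign L hL).1 ?_
      rw [hq, inner_smul_add_smul]
      exact add_pos (mul_pos hs h1) (mul_pos ht (hle L hL h1))
    · refine (hsign K' hK').1 ?_
      rw [hq, inner_smul_add_smul]
      nlinarith
  · refine N.regLT_of_regLE hz hy ((N.regLE_iff hz hy).2 fun L hL h1 => ?_) hK ?_ hKy
    · by_contra h2
      have h3 : ⟪ν L, y⟫ < 0 := (hy L hL).lt_of_le (not_lt.1 h2)
      have h4 : ⟪ν L, x⟫ < 0 :=
        (hx L hL).lt_of_le (not_lt.1 fun h5 => h2 (hle L hL h5))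
      refine h1.not_gt ((hsign L hL).2 ?_)
      rw [hq, inner_smul_add_smul]
      exact add_neg (mul_neg_of_pos_of_neg hs h4) (mul_neg_of_pos_of_neg ht h3)
    · refine (hsign K hK).2 ?_
      rw [hq, inner_smul_add_smul]
      nlinarith

/-- If two distinct hyperplanes separate `x` from `y`, then there is a region strictly between
the regions of `x` and `y`. -/
theorem exists_between (N : IsNormalSystem A b ν) {x y : EuclideanSpace ℝ (Fin n)}
    (hx : IsGeneric A ν x) (hy : IsGeneric A ν y)
    (hle : regLE A (region A ν b) (region A ν x) (region A ν y))
    {K K' : Set (EuclideanSpace ℝ (Fin n))} (hK : K ∈ A) (hK' : K' ∈ A) (hne : K ≠ K')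
    (hKx : ⟪ν K, x⟫ < 0) (hKx' : ⟪ν K', x⟫ < 0) (hKy : 0 < ⟪ν K, y⟫) (hKy' : 0 < ⟪ν K', y⟫) :
    ∃ z, IsGeneric A ν z ∧ regLT A (region A ν b) (region A ν x) (region A ν z) ∧
      regLT A (region A ν b) (region A ν z) (region A ν y) := by
  set w := ⟪ν K', x⟫ • ν K - ⟪ν K, x⟫ • ν K' with hw
  have hw0 : w ≠ 0 := fun h0 => hne <| Set.ext fun u => by
    rw [N.mem_iff K hK, N.mem_iff K' hK']
    exact inner_eq_zero_iff_of_proportional hKx.ne hKx'.ne h0 u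
  obtain ⟨y', hyy', hwy'⟩ : ∃ y', (∀ L ∈ A, 0 < ⟪ν L, y⟫ * ⟪ν L, y'⟫) ∧ ⟪w, y'⟫ ≠ 0 := by
    by_cases h0 : ⟪w, y⟫ = 0
    · obtain ⟨ε, hε, hsign⟩ := exists_pos_perturb (ν := ν) N.finite y w
      refine ⟨y + ε • w, fun L hL => ?_, ?_⟩
      · rcases (hy L hL).lt_or_gt with h | h
        · exact mul_pos_of_neg_of_neg h ((hsign L hL).2 h)
        · exact mul_pos h ((hsign L hL).1 h)
      · rw [inner_add_smul, h0, zero_add]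
        exact mul_ne_zero hε.ne' (inner_self_ne_zero.2 hw0)
    · exact ⟨y, fun L hL => mul_self_pos.2 (hy L hL), h0⟩
  have hgen : IsGeneric A ν y' := fun L hL => right_ne_zero_of_mul (hyy' L hL).ne'
  have hreg : region A ν y = region A ν y' := congrArg closure (cell_congr _ hyy')
  rw [hreg] at hle ⊢
  have hle' := (N.regLE_iff hx hgen).1 hle
  have h1 := (pos_iff_pos_of_mul_pos (hyy' K hK)).1 hKy
  have h2 := (pos_iff_pos_of_mul_pos (hyy' K' hK')).1 hKy'
  rw [hw, inner_sub_left, real_inner_smul_left, real_inner_smul_left, sub_ne_zero] at hwy'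
  rcases hwy'.lt_or_gt with h | h
  · exact N.exists_between_of_lt hgen hle' hK' hK h hx hKx' hKx h2 h1
  · exact N.exists_between_of_lt hgen hle' hK hK' h hx hKx hKx' h1 h2

/-- Along a cover relation the separating set grows by exactly one hyperplane. -/
theorem sepSet_eq_insert_of_covers (N : IsNormalSystem A b ν)
    {R R' : Set (EuclideanSpace ℝ (Fin n))} (hR : IsRegion A R)
    (h : CoversReg A (region A ν b) R R') :
    ∃ K ∈ A, K ∉ sepSet A (region A ν b) R' ∧
      sepSet A (region A ν b) R = insert K (sepSet A (region A ν b) R') := by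
  obtain ⟨hR', hlt, hcov⟩ := h
  obtain ⟨y, hy, rfl⟩ := N.isRegion_iff.1 hR
  obtain ⟨x, hx, rfl⟩ := N.isRegion_iff.1 hR'
  obtain ⟨K, hKy, hKx⟩ := Set.not_subset.1 hlt.2
  refine ⟨K, hKy.1, hKx, Set.Subset.antisymm (fun L hLy => ?_) (Set.insert_subset hKy hlt.1)⟩
  by_contra hL
  rw [Set.mem_insert_iff, not_or] at hL
  rw [N.mem_sepSet hx] at hKx hL
  rw [N.mem_sepSet hy] at hKy hLy
  have hKx' := (hx K hKy.1).lt_of_le (not_lt.1 fun h => hKx ⟨hKy.1, h⟩)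
  have hLx' := (hx L hLy.1).lt_of_le (not_lt.1 fun h => hL.2 ⟨hLy.1, h⟩)
  obtain ⟨z, hz, h1, h2⟩ :=
    N.exists_between hx hy hlt.1 hKy.1 hLy.1 (Ne.symm hL.1) hKx' hLx' hKy.2 hLy.2
  exact hcov _ (N.isRegion_iff.2 ⟨z, hz, rfl⟩) h1 h2

theorem covers_of_sepSet_eq_insert {B R R' K : Set (EuclideanSpace ℝ (Fin n))}
    (hR' : IsRegion A R') (hK : K ∉ sepSet A B R')
    (h : sepSet A B R = insert K (sepSet A B R')) : CoversReg A B R R' := by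
  refine ⟨hR', ⟨(Set.subset_insert _ _).trans h.superset,
    fun h' => hK (h' (h ▸ Set.mem_insert _ _))⟩,
    fun X _ h1 h2 => ?_⟩
  obtain ⟨L, hLX, hL⟩ := Set.not_subset.1 h1.2
  obtain rfl : L = K := by
    have := h2.1 hLX
    rw [h] at this
    exact this.resolve_right hL
  exact h2.2 (h.subset.trans (Set.insert_subset hLX h1.1))

theorem finite_image_sepSet (N : IsNormalSystem A b ν) (B : Set (EuclideanSpace ℝ (Fin n)))
    (s : Set (Set (EuclideanSpace ℝ (Fin n)))) : (sepSet A B '' s).Finite :=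
  N.finite.finite_subsets.subset (Set.image_subset_iff.2 fun _ _ _ hK => hK.1)

theorem exists_covers_ge (N : IsNormalSystem A b ν) {B X J : Set (EuclideanSpace ℝ (Fin n))}
    (hX : IsRegion A X) (h : regLT A B X J) : ∃ Y, regLE A B X Y ∧ CoversReg A B J Y := by
  obtain ⟨Y, ⟨hY, hXY, hYJ⟩, hmax⟩ := Set.Finite.exists_maximalFor' (sepSet A B)
    {R | IsRegion A R ∧ regLE A B X R ∧ regLT A B R J} (N.finite_image_sepSet B _)
    ⟨X, hX, subset_rfl, h⟩
  exact ⟨Y, hXY, hY, hYJ, fun R hR h1 h2 => h1.2 (hmax ⟨hR, hXY.trans h1.1, h2⟩ h1.1)⟩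

theorem exists_covers_le (N : IsNormalSystem A b ν) {B X M : Set (EuclideanSpace ℝ (Fin n))}
    (hM : IsRegion A M) (hX : IsRegion A X) (h : regLT A B M X) :
    ∃ Y, IsRegion A Y ∧ regLE A B Y X ∧ CoversReg A B Y M := by
  obtain ⟨Y, ⟨hY, hXY, hYJ⟩, hmin⟩ := Set.Finite.exists_minimalFor' (sepSet A B)
    {R | IsRegion A R ∧ regLE A B R X ∧ regLT A B M R} (N.finite_image_sepSet B _)
    ⟨X, hX, subset_rfl, h⟩
  exact ⟨Y, hY, hXY, hM, hYJ, fun R hR h1 h2 => h2.2 (hmin ⟨hR, h2.1.trans hXY, h1⟩ h2.1)⟩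

end IsNormalSystem

/-- `p` lies on `H` and strictly on the same side as `x` of every other hyperplane of `A`. -/
def IsFacetPoint (A : Set (Set (EuclideanSpace ℝ (Fin n))))
    (ν : Set (EuclideanSpace ℝ (Fin n)) → EuclideanSpace ℝ (Fin n))
    (H : Set (EuclideanSpace ℝ (Fin n))) (x p : EuclideanSpace ℝ (Fin n)) : Prop :=
  p ∈ cell (A \ {H}) ν H x

/-- The hyperplanes cutting `H` into shards. -/
def cutters (A : Set (Set (EuclideanSpace ℝ (Fin n)))) (B H : Set (EuclideanSpace ℝ (Fin n))) :
    Set (Set (EuclideanSpace ℝ (Fin n))) :=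
  {H' | H' ∈ A ∧ H' ≠ H ∧ ¬ IsBasicIn (pencil A H H') B H}

namespace IsNormalSystem

variable {A : Set (Set (EuclideanSpace ℝ (Fin n)))} {b : EuclideanSpace ℝ (Fin n)}
  {ν : Set (EuclideanSpace ℝ (Fin n)) → EuclideanSpace ℝ (Fin n)}
  {H Sg : Set (EuclideanSpace ℝ (Fin n))} {x p : EuclideanSpace ℝ (Fin n)}

theorem cutters_subset (B : Set (EuclideanSpace ℝ (Fin n))) : cutters A B H ⊆ A \ {H} :=
  fun _ hK => ⟨hK.1, hK.2.1⟩

theorem shardCut_eq (N : IsNormalSystem A b ν) (B : Set (EuclideanSpace ℝ (Fin n))) :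
    shardCut A B H = {y | y ∈ H ∧ IsGeneric (cutters A B H) ν y} := by
  ext y
  simp only [shardCut, Set.mem_sdiff, Set.mem_iUnion, not_exists, Set.mem_ofPred_eq]
  refine and_congr_right fun hy => forall₂_congr fun K hK => ?_
  rw [Set.mem_inter_iff, N.mem_iff K hK.1]
  exact ⟨fun h h0 => h ⟨hy, h0⟩, fun h h0 => h h0.2⟩

theorem convex_hyperplane (N : IsNormalSystem A b ν) (hH : H ∈ A) : Convex ℝ H := by
  intro y hy z hz s t _ _ _
  rw [N.mem_iff H hH] at *
  rw [inner_smul_add_smul, hy, hz]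
  simp

theorem isShardOf_iff (N : IsNormalSystem A b ν) (B : Set (EuclideanSpace ℝ (Fin n))) :
    IsShardOf A B H Sg ↔ H ∈ A ∧ ∃ x, x ∈ H ∧ IsGeneric (cutters A B H) ν x ∧
      Sg = cell (cutters A B H) ν H x := by
  rw [IsShardOf, N.shardCut_eq]
  refine and_congr_right fun hH => exists_congr fun x => ?_
  rw [Set.mem_ofPred_eq, and_assoc]
  refine and_congr_right fun hx => and_congr_right fun hx' => ?_
  rw [connectedComponentIn_eq_cell (N.convex_hyperplane hH) hx hx']

theorem shard_eq_cell (N : IsNormalSystem A b ν) {B : Set (EuclideanSpace ℝ (Fin n))}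
    (hS : IsShardOf A B H Sg) (hp : p ∈ Sg) : Sg = cell (cutters A B H) ν H p := by
  obtain ⟨-, y, -, -, rfl⟩ := (N.isShardOf_iff B).1 hS
  exact cell_congr H hp.2

theorem exists_facetPoint_of_span (N : IsNormalSystem A b ν)
    {B : Set (EuclideanSpace ℝ (Fin n))} (hS : IsShardOf A B H Sg) (hx : IsGeneric A ν x)
    (h : Submodule.span ℝ (region A ν x ∩ Sg) = Submodule.span ℝ H) :
    ∃ p ∈ Sg, IsFacetPoint A ν H x p := by
  obtain ⟨hH, y, hy, -, rfl⟩ := (N.isShardOf_iff B).1 hS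
  have hex : ∀ K, ∃ q, K ∈ A \ {H} →
      (q ∈ region A ν x ∩ cell (cutters A B H) ν H y ∧ ⟪ν K, q⟫ ≠ 0) := by
    intro K
    by_contra! hcon
    have hKA : K ∈ A \ {H} := (hcon 0).1
    have hK0 : ∀ q ∈ region A ν x ∩ cell (cutters A B H) ν H y, ⟪ν K, q⟫ = 0 :=
      fun q hq => (hcon q).2 hq
    refine hKA.2 (N.eq_of_subset hH hKA.1 fun w hw => ?_).symm
    have hw' : w ∈ Submodule.span ℝ (region A ν x ∩ cell (cutters A B H) ν H y) :=
      h ▸ Submodule.subset_span hw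
    have hle : Submodule.span ℝ (region A ν x ∩ cell (cutters A B H) ν H y) ≤
        LinearMap.ker (innerₛₗ ℝ (ν K)) :=
      Submodule.span_le.2 fun q hq => by simpa using hK0 q hq
    rw [N.mem_iff K hKA.1]
    simpa using hle hw'
  choose f hf using hex
  have hfin : (A \ {H}).Finite := N.finite.subset Set.sdiff_subset
  have hinner : ∀ v, ⟪v, ∑ K ∈ hfin.toFinset, f K⟫ = ∑ K ∈ hfin.toFinset, ⟪v, f K⟫ :=
    fun v => inner_sum _ _ _
  have hmem : ∑ K ∈ hfin.toFinset, f K ∈ H := by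
    rw [N.mem_iff H hH, hinner]
    exact Finset.sum_eq_zero fun K hK =>
      (N.mem_iff H hH _).1 (hf K (hfin.mem_toFinset.1 hK)).1.2.1
  refine ⟨∑ K ∈ hfin.toFinset, f K, ⟨hmem, fun L hL => ?_⟩, hmem, fun L hL => ?_⟩
  · rw [hinner, Finset.mul_sum]
    exact Finset.sum_pos (fun K hK => (hf K (hfin.mem_toFinset.1 hK)).1.2.2 L hL)
      ⟨L, hfin.mem_toFinset.2 (cutters_subset B hL)⟩
  · rw [hinner, Finset.mul_sum]
    have hnn : ∀ K ∈ A \ {H}, 0 ≤ ⟪ν L, x⟫ * ⟪ν L, f K⟫ :=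
      fun K hK => (mem_region hx).1 (hf K hK).1.1 L hL.1
    exact Finset.sum_pos' (fun K hK => hnn K (hfin.mem_toFinset.1 hK))
      ⟨L, hfin.mem_toFinset.2 hL,
        (hnn L hL).lt_of_ne (mul_ne_zero (hx L hL.1) (hf L hL).2).symm⟩

theorem _root_.IsFacetPoint.mem_region (N : IsNormalSystem A b ν) (hH : H ∈ A)
    (hx : IsGeneric A ν x) (hp : IsFacetPoint A ν H x p) {y : EuclideanSpace ℝ (Fin n)}
    (hy : y ∈ cell (A \ {H}) ν H p) : y ∈ region A ν x := by
  refine (IsNormalSystem.mem_region hx).2 fun K hK => ?_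
  by_cases hKH : K = H
  · rw [hKH, (N.mem_iff H hH y).1 hy.1, mul_zero]
  · exact (mul_pos_trans (hp.2 K ⟨hK, hKH⟩) (hy.2 K ⟨hK, hKH⟩)).le

theorem _root_.IsFacetPoint.isGeneric (hp : IsFacetPoint A ν H x p) :
    IsGeneric (A \ {H}) ν p :=
  fun K hK => right_ne_zero_of_mul (hp.2 K hK).ne'

theorem span_region_inter_eq (N : IsNormalSystem A b ν)
    {B : Set (EuclideanSpace ℝ (Fin n))} (hS : IsShardOf A B H Sg) (hx : IsGeneric A ν x)
    (hpS : p ∈ Sg) (hp : IsFacetPoint A ν H x p) :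
    Submodule.span ℝ (region A ν x ∩ Sg) = Submodule.span ℝ H := by
  rw [N.shard_eq_cell hS hpS]
  refine span_eq_of_nearby (N.finite.subset Set.sdiff_subset) (N.mem_iff H hS.1) hp.1 hp.isGeneric
    (fun y hy => hy.2.1) fun y hy => ⟨hp.mem_region N hS.1 hx hy, hy.1, fun K hK => ?_⟩
  exact hy.2 K (cutters_subset B hK)

theorem mem_upperRegions (N : IsNormalSystem A b ν)
    (hS : IsShardOf A (region A ν b) H Sg) (hx : IsGeneric A ν x) :
    region A ν x ∈ upperRegions A (region A ν b) H Sg ↔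
      0 < ⟪ν H, x⟫ ∧ ∃ p ∈ Sg, IsFacetPoint A ν H x p := by
  rw [upperRegions, Set.mem_ofPred_eq, N.mem_sepSet hx]
  constructor
  · rintro ⟨-, h, -, hpos⟩
    exact ⟨hpos, N.exists_facetPoint_of_span hS hx h⟩
  · rintro ⟨hpos, p, hpS, hp⟩
    exact ⟨N.isRegion_iff.2 ⟨x, hx, rfl⟩, N.span_region_inter_eq hS hx hpS hp, hS.1, hpos⟩

theorem mem_lowerRegions (N : IsNormalSystem A b ν)
    (hS : IsShardOf A (region A ν b) H Sg) (hx : IsGeneric A ν x) :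
    region A ν x ∈ lowerRegions A (region A ν b) H Sg ↔
      ⟪ν H, x⟫ < 0 ∧ ∃ p ∈ Sg, IsFacetPoint A ν H x p := by
  rw [lowerRegions, Set.mem_ofPred_eq, N.mem_sepSet hx]
  constructor
  · rintro ⟨-, h, hneg⟩
    exact ⟨(hx H hS.1).lt_of_le (not_lt.1 fun h => hneg ⟨hS.1, h⟩),
      N.exists_facetPoint_of_span hS hx h⟩
  · rintro ⟨hneg, p, hpS, hp⟩
    exact ⟨N.isRegion_iff.2 ⟨x, hx, rfl⟩, N.span_region_inter_eq hS hx hpS hp,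
      fun h => hneg.not_gt h.2⟩

/-- If `H` is not basic in its pencil with `H'`, then every generic point of `H` lies above some
other hyperplane of that pencil. -/
theorem exists_pos_of_mem_cutters (N : IsNormalSystem A b ν) (hH : H ∈ A) (hp : p ∈ H)
    (hgen : IsGeneric (A \ {H}) ν p) {H' : Set (EuclideanSpace ℝ (Fin n))}
    (hH' : H' ∈ cutters A (region A ν b) H) :
    ∃ K ∈ A, H ∩ H' ⊆ K ∧ 0 < ⟪ν K, p⟫ := by
  by_contra! hcon
  have hsub : pencil A H H' ⊆ A := fun K hK => hK.1
  have hHP : H ∈ pencil A H H' := ⟨hH, Set.inter_subset_left⟩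
  have N' := N.mono hsub
  have hfacet : IsFacetPoint (pencil A H H') ν H b p := by
    refine ⟨hp, fun K hK => mul_pos_of_neg_of_neg (N.neg K (hsub hK.1)) ?_⟩
    exact (hgen K ⟨hsub hK.1, hK.2⟩).lt_of_le (hcon K hK.1.1 hK.1.2)
  refine hH'.2.2 ⟨hHP, region (pencil A H H') ν b,
    N'.isRegion_iff.2 ⟨b, N'.isGeneric_base, rfl⟩, fun y hy => ?_, ?_⟩
  · exact (mem_region N'.isGeneric_base).2 fun K hK =>
      (mem_region N.isGeneric_base).1 hy K (hsub hK)
  · exact span_eq_of_nearby (N'.finite.subset Set.sdiff_subset) (N.mem_iff H hH) hp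
      hfacet.isGeneric Set.inter_subset_left
      fun y hy => ⟨hy.1, hfacet.mem_region N' hHP N'.isGeneric_base hy⟩

/-- Two points of `H` lie in the same shard if moving from one to the other crosses the
hyperplanes other than `H` only upwards. -/
theorem mem_cell_cutters (N : IsNormalSystem A b ν) (hH : H ∈ A) (hp : p ∈ H)
    (hgen : IsGeneric (A \ {H}) ν p) {q : EuclideanSpace ℝ (Fin n)} (hq : q ∈ H)
    (hpq : ∀ K ∈ A, 0 < ⟪ν K, p⟫ → 0 < ⟪ν K, q⟫) :
    q ∈ cell (cutters A (region A ν b) H) ν H p := by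
  refine ⟨hq, fun H' hH' => ?_⟩
  by_contra hneg
  obtain ⟨K, hK, hsub, hKp⟩ := N.exists_pos_of_mem_cutters hH hp hgen hH'
  have h0 := hgen H' (cutters_subset _ hH')
  have hz : (⟪ν H', p⟫ * ⟪ν H', p⟫) • q + (-(⟪ν H', p⟫ * ⟪ν H', q⟫)) • p ∈ K := by
    refine hsub ⟨?_, ?_⟩
    · rw [N.mem_iff H hH, inner_smul_add_smul, (N.mem_iff H hH p).1 hp, (N.mem_iff H hH q).1 hq]
      simp
    · rw [N.mem_iff H' hH'.1, inner_smul_add_smul]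
      ring
  rw [N.mem_iff K hK, inner_smul_add_smul] at hz
  have h1 := mul_pos (mul_self_pos.2 h0) (hpq K hK hKp)
  have h2 := mul_nonneg (neg_nonneg.2 (not_lt.1 hneg)) hKp.le
  linarith

/-- The facet between two regions whose separating sets differ exactly by `H`. -/
theorem exists_facetPoint_of_sepSet_eq_insert (N : IsNormalSystem A b ν) (hH : H ∈ A)
    {x y : EuclideanSpace ℝ (Fin n)} (hx : IsGeneric A ν x) (hy : IsGeneric A ν y)
    (hHx : H ∉ sepSet A (region A ν b) (region A ν x))
    (h : sepSet A (region A ν b) (region A ν y) =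
      insert H (sepSet A (region A ν b) (region A ν x))) :
    ∃ p, IsFacetPoint A ν H x p ∧ IsFacetPoint A ν H y p := by
  have hHy : H ∈ sepSet A (region A ν b) (region A ν y) := h ▸ Set.mem_insert _ _
  rw [N.mem_sepSet hx] at hHx
  rw [N.mem_sepSet hy] at hHy
  have hneg : ⟪ν H, x⟫ < 0 := (hx H hH).lt_of_le (not_lt.1 fun h => hHx ⟨hH, h⟩)
  have hxy : ∀ K ∈ A \ {H}, 0 < ⟪ν K, x⟫ * ⟪ν K, y⟫ := by
    intro K hK
    have hiff : 0 < ⟪ν K, y⟫ ↔ 0 < ⟪ν K, x⟫ := by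
      have h1 := Set.ext_iff.1 h K
      rw [Set.mem_insert_iff, N.mem_sepSet hx, N.mem_sepSet hy] at h1
      simpa [hK.1, Set.mem_singleton_iff.not.1 hK.2] using h1
    rcases (hx K hK.1).lt_or_gt with h1 | h1
    · exact mul_pos_of_neg_of_neg h1
        ((hy K hK.1).lt_of_le (not_lt.1 fun h2 => h1.not_gt (hiff.1 h2)))
    · exact mul_pos h1 (hiff.2 h1)
  have hmem : ⟪ν H, y⟫ • x + (-⟪ν H, x⟫) • y ∈ H := by
    rw [N.mem_iff H hH, inner_smul_add_smul]; ring
  refine ⟨_, ⟨hmem, fun K hK => ?_⟩, hmem, fun K hK => ?_⟩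
  · rw [inner_smul_add_smul]
    have h1 := mul_pos hHy.2 (mul_self_pos.2 (hx K hK.1))
    have h2 := mul_pos (neg_pos.2 hneg) (hxy K hK)
    linarith
  · rw [inner_smul_add_smul]
    have h1 := mul_pos hHy.2 (hxy K hK)
    have h2 := mul_pos (neg_pos.2 hneg) (mul_self_pos.2 (hy K hK.1))
    linarith

/-- Every region above a maximal element `M` of the lower regions of a shard lies above the
hyperplane of that shard. -/
theorem mem_sepSet_of_maximalInL (N : IsNormalSystem A b ν) {M X : Set (EuclideanSpace ℝ (Fin n))}
    (hS : IsShardOf A (region A ν b) H Sg) (hM : MaximalInL A (region A ν b) H Sg M)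
    (hX : IsRegion A X) (hlt : regLT A (region A ν b) M X) :
    H ∈ sepSet A (region A ν b) X := by
  by_contra hHX
  have hH := hS.1
  obtain ⟨m, hm, rfl⟩ := N.isRegion_iff.1 hM.1.1
  obtain ⟨x, hx, rfl⟩ := N.isRegion_iff.1 hX
  obtain ⟨hHm, p, hpS, hp⟩ := (N.mem_lowerRegions hS hm).1 hM.1
  rw [N.mem_sepSet hx] at hHX
  have hHx : ⟪ν H, x⟫ < 0 := (hx H hH).lt_of_le (not_lt.1 fun h => hHX ⟨hH, h⟩)
  have hHb := N.neg H hH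
  have hFfin : (A \ {H}).Finite := N.finite.subset Set.sdiff_subset
  set q₀ := (-⟪ν H, b⟫) • x + ⟪ν H, x⟫ • b with hq₀
  obtain ⟨ε, -, hqgen, hqsign⟩ := exists_perturb hFfin q₀ hp.isGeneric
  set q := q₀ + ε • p with hq
  have hqH : q ∈ H := by
    rw [N.mem_iff H hH, hq, hq₀, inner_add_smul, inner_smul_add_smul, (N.mem_iff H hH p).1 hp.1]
    ring
  have hxq : ∀ K ∈ A \ {H}, 0 < ⟪ν K, x⟫ → 0 < ⟪ν K, q⟫ := by
    refine fun K hK hKx => (hqsign K hK).1 ?_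
    rw [hq₀, inner_smul_add_smul]
    exact add_pos (mul_pos (neg_pos.2 hHb) hKx) (mul_pos_of_neg_of_neg hHx (N.neg K hK.1))
  have hmx := (N.regLE_iff hm hx).1 hlt.1
  have hqcell : q ∈ cell (cutters A (region A ν b) H) ν H p := by
    refine N.mem_cell_cutters hH hp.1 hp.isGeneric hqH fun K hK hKp => ?_
    have hKH : K ∈ A \ {H} := by
      refine ⟨hK, fun h => ?_⟩
      rw [Set.mem_singleton_iff.1 h, (N.mem_iff H hH p).1 hp.1] at hKp
      exact hKp.false
    exact hxq K hKH (hmx K hK ((pos_iff_pos_of_mul_pos (hp.2 K hKH)).2 hKp))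
  rw [← N.shard_eq_cell hS hpS] at hqcell
  obtain ⟨δ, hδ, hzsign⟩ := exists_pos_perturb (ν := ν) hFfin q b
  set z := q + δ • b with hz
  have hHz : ⟪ν H, z⟫ < 0 := by
    rw [hz, inner_add_smul, (N.mem_iff H hH q).1 hqH, zero_add]
    exact mul_neg_of_pos_of_neg hδ hHb
  have hzq : ∀ K ∈ A \ {H}, 0 < ⟪ν K, z⟫ * ⟪ν K, q⟫ := by
    intro K hK
    rcases (hqgen K hK).lt_or_gt with h | h
    · exact mul_pos_of_neg_of_neg ((hzsign K hK).2 h) h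
    · exact mul_pos ((hzsign K hK).1 h) h
  have hzgen : IsGeneric A ν z := by
    intro K hK
    by_cases hKH : K = H
    · exact hKH ▸ hHz.ne
    · exact left_ne_zero_of_mul (hzq K ⟨hK, hKH⟩).ne'
  have hxz : regLE A (region A ν b) (region A ν x) (region A ν z) := by
    refine (N.regLE_iff hx hzgen).2 fun K hK hKx => ?_
    have hKH : K ∈ A \ {H} :=
      ⟨hK, fun h => hHx.not_gt (Set.mem_singleton_iff.1 h ▸ hKx)⟩
    exact (hzsign K hKH).1 (hxq K hKH hKx)
  have hzL : region A ν z ∈ lowerRegions A (region A ν b) H Sg :=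
    (N.mem_lowerRegions hS hzgen).2 ⟨hHz, q, hqcell, hqH, hzq⟩
  exact hlt.2 (hxz.trans (hM.2 _ hzL (hlt.1.trans hxz)))

/-- The region on the other side of the facet of an upper region. -/
theorem exists_sepSet_eq_insert_of_mem_upperRegions (N : IsNormalSystem A b ν)
    {J : Set (EuclideanSpace ℝ (Fin n))} (hS : IsShardOf A (region A ν b) H Sg)
    (hJ : J ∈ upperRegions A (region A ν b) H Sg) :
    ∃ Y, IsRegion A Y ∧ H ∉ sepSet A (region A ν b) Y ∧
      sepSet A (region A ν b) J = insert H (sepSet A (region A ν b) Y) := by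
  have hH := hS.1
  obtain ⟨x, hx, rfl⟩ := N.isRegion_iff.1 hJ.1
  obtain ⟨hHx, p, -, hp⟩ := (N.mem_upperRegions hS hx).1 hJ
  obtain ⟨δ, hδ, hsign⟩ :=
    exists_pos_perturb (ν := ν) (N.finite.subset (Set.sdiff_subset (t := {H}))) p b
  set z := p + δ • b with hz
  have hHz : ⟪ν H, z⟫ < 0 := by
    rw [hz, inner_add_smul, (N.mem_iff H hH p).1 hp.1, zero_add]
    exact mul_neg_of_pos_of_neg hδ (N.neg H hH)
  have hxz : ∀ K ∈ A \ {H}, 0 < ⟪ν K, x⟫ * ⟪ν K, z⟫ := by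
    intro K hK
    refine mul_pos_trans (hp.2 K hK) ?_
    rcases (hp.isGeneric K hK).lt_or_gt with h | h
    · exact mul_pos_of_neg_of_neg h ((hsign K hK).2 h)
    · exact mul_pos h ((hsign K hK).1 h)
  have hzgen : IsGeneric A ν z := by
    intro K hK
    by_cases hKH : K = H
    · exact hKH ▸ hHz.ne
    · exact right_ne_zero_of_mul (hxz K ⟨hK, hKH⟩).ne'
  refine ⟨region A ν z, N.isRegion_iff.2 ⟨z, hzgen, rfl⟩, ?_, ?_⟩
  · rw [N.mem_sepSet hzgen]
    exact fun h => hHz.not_gt h.2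
  · ext K
    rw [Set.mem_insert_iff, N.mem_sepSet hx, N.mem_sepSet hzgen]
    by_cases hKH : K = H
    · subst hKH
      simp [hH, hHx]
    · simp only [hKH, false_or]
      exact and_congr_right fun hK => pos_iff_pos_of_mul_pos (hxz K ⟨hK, hKH⟩)

theorem exists_isNormalSystem (hA : IsCentralArrangement A) {B : Set (EuclideanSpace ℝ (Fin n))}
    (hB : IsRegion A B) : ∃ b ν, IsNormalSystem A b ν ∧ B = region A ν b := by
  obtain ⟨b, hb, rfl⟩ := hB
  have hex : ∀ K : Set (EuclideanSpace ℝ (Fin n)), ∃ v : EuclideanSpace ℝ (Fin n),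
      K ∈ A → (∀ x, x ∈ K ↔ ⟪v, x⟫ = 0) ∧ ⟪v, b⟫ < 0 := by
    intro K
    by_cases hK : K ∈ A
    · obtain ⟨v, -, hv⟩ := hA.2.2 K hK
      have hbK : b ∉ K := fun h => hb (Set.mem_biUnion hK h)
      have hmem : ∀ x, x ∈ K ↔ ⟪v, x⟫ = 0 := fun x => by rw [hv, Set.mem_ofPred_eq]
      rw [hmem] at hbK
      rcases Ne.lt_or_gt hbK with h | h
      · exact ⟨v, fun _ => ⟨hmem, h⟩⟩
      · exact ⟨-v, fun _ => ⟨fun x => by rw [hmem, inner_neg_left, neg_eq_zero],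
          by rwa [inner_neg_left, neg_lt_zero]⟩⟩
    · exact ⟨0, fun h => absurd h hK⟩
  choose ν hν using hex
  have N : IsNormalSystem A b ν :=
    ⟨hA.1, fun K hK => (hν K hK).1, fun K hK => (hν K hK).2⟩
  refine ⟨b, ν, N, ?_⟩
  have := connectedComponentIn_eq_cell (A := A) (ν := ν) convex_univ (Set.mem_univ b)
    N.isGeneric_base
  rw [N.arrComplement_eq, this]

/-- A subcritical pair is separated by a single hyperplane, through which `J` covers its unique
lower cover and `M` is covered. -/
theorem exists_hyperplane_of_subcritReg (N : IsNormalSystem A b ν)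
    {J M : Set (EuclideanSpace ℝ (Fin n))} (h : SubcritReg A (region A ν b) J M) :
    ∃ H ∈ A, H ∉ sepSet A (region A ν b) M ∧
      (∃ Y, IsRegion A Y ∧ regLE A (region A ν b) Y M ∧ H ∉ sepSet A (region A ν b) Y ∧
        sepSet A (region A ν b) J = insert H (sepSet A (region A ν b) Y)) ∧
      ∃ Z, IsRegion A Z ∧
        sepSet A (region A ν b) Z = insert H (sepSet A (region A ν b) M) := by
  obtain ⟨hJ, hM, hnle, hJM, hMJ⟩ := h
  have hbot : sepSet A (region A ν b) (region A ν b) = ∅ := by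
    refine Set.eq_empty_of_forall_notMem fun K hK => ?_
    have hK' := (N.mem_sepSet N.isGeneric_base K).1 hK
    exact (N.neg K hK'.1).not_gt hK'.2
  have hneg : IsGeneric A ν (-b) := fun K hK => by
    rw [inner_neg_right]; exact (neg_pos.2 (N.neg K hK)).ne'
  have htop : ∀ K ∈ A, K ∈ sepSet A (region A ν b) (region A ν (-b)) := fun K hK => by
    rw [N.mem_sepSet hneg, inner_neg_right]; exact ⟨hK, neg_pos.2 (N.neg K hK)⟩
  obtain ⟨L, hLJ, hLM⟩ := Set.not_subset.1 hnle
  have hBJ : regLT A (region A ν b) (region A ν b) J :=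
    ⟨hbot.subset.trans (Set.empty_subset _), fun h => by simpa [hbot] using h hLJ⟩
  obtain ⟨Y, -, hcov⟩ := N.exists_covers_ge (N.isRegion_iff.2 ⟨b, N.isGeneric_base, rfl⟩) hBJ
  obtain ⟨H, hH, hHY, hins⟩ := N.sepSet_eq_insert_of_covers hJ hcov
  have hYM := hJM Y hcov.1 hcov.2.1
  have hHM : H ∉ sepSet A (region A ν b) M := fun h =>
    hnle (hins.subset.trans (Set.insert_subset h hYM))
  have hMT : regLT A (region A ν b) M (region A ν (-b)) :=
    ⟨fun K hK => htop K hK.1, fun h => hHM (h (htop H hH))⟩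
  obtain ⟨Z, hZ, -, hcovZ⟩ :=
    N.exists_covers_le hM (N.isRegion_iff.2 ⟨-b, hneg, rfl⟩) hMT
  obtain ⟨K, -, -, hinsZ⟩ := N.sepSet_eq_insert_of_covers hZ hcovZ
  have hHZ : H ∈ sepSet A (region A ν b) Z :=
    hMJ Z hZ hcovZ.2.1 (hins.superset (Set.mem_insert _ _))
  obtain rfl : H = K := (hinsZ.subset hHZ).resolve_right hHM
  exact ⟨H, hH, hHM, ⟨Y, hcov.1, hYM, hHY, hins⟩, Z, hZ, hinsZ⟩

theorem exists_shard_of_subcritReg (N : IsNormalSystem A b ν)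
    {J M : Set (EuclideanSpace ℝ (Fin n))} (h : SubcritReg A (region A ν b) J M) :
    ∃ H Sg, IsShardOf A (region A ν b) H Sg ∧ MinimalInU A (region A ν b) H Sg J ∧
      MaximalInL A (region A ν b) H Sg M ∧
        ∃ Jst, CoversReg A (region A ν b) J Jst ∧
          (∀ J', CoversReg A (region A ν b) J J' → J' = Jst) ∧
          regLE A (region A ν b) Jst M := by
  obtain ⟨H, hH, hHM, ⟨Y, hY, hYM, hHY, hinsJ⟩, Z, hZ, hinsM⟩ :=
    N.exists_hyperplane_of_subcritReg h
  obtain ⟨hJ, hM, hnle, hJM, hMJ⟩ := h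
  have hHJ : H ∈ sepSet A (region A ν b) J := hinsJ.superset (Set.mem_insert _ _)
  obtain ⟨j, hj, rfl⟩ := N.isRegion_iff.1 hJ
  obtain ⟨m, hm, rfl⟩ := N.isRegion_iff.1 hM
  obtain ⟨y, hy, rfl⟩ := N.isRegion_iff.1 hY
  obtain ⟨z, hz, rfl⟩ := N.isRegion_iff.1 hZ
  obtain ⟨p, hpy, hpj⟩ := N.exists_facetPoint_of_sepSet_eq_insert hH hy hj hHY hinsJ
  obtain ⟨q, hqm, -⟩ := N.exists_facetPoint_of_sepSet_eq_insert hH hm hz hHM hinsM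
  have hpgen : IsGeneric (cutters A (region A ν b) H) ν p :=
    fun K hK => hpj.isGeneric K (cutters_subset _ hK)
  have hq : q ∈ cell (cutters A (region A ν b) H) ν H p := by
    refine N.mem_cell_cutters hH hpj.1 hpj.isGeneric hqm.1 fun K hK hKp => ?_
    have hKH : K ∈ A \ {H} := by
      refine ⟨hK, fun h => ?_⟩
      rw [Set.mem_singleton_iff.1 h, (N.mem_iff H hH p).1 hpj.1] at hKp
      exact hKp.false
    refine (pos_iff_pos_of_mul_pos (hqm.2 K hKH)).1 ?_
    exact (N.regLE_iff hy hm).1 hYM K hK ((pos_iff_pos_of_mul_pos (hpy.2 K hKH)).2 hKp)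
  have hS : IsShardOf A (region A ν b) H (cell (cutters A (region A ν b) H) ν H p) :=
    (N.isShardOf_iff _).2 ⟨hH, p, hpj.1, hpgen, rfl⟩
  refine ⟨H, _, hS, ⟨(N.mem_upperRegions hS hj).2 ⟨((N.mem_sepSet hj H).1 hHJ).2, p,
      ⟨hpj.1, fun K hK => mul_self_pos.2 (hpgen K hK)⟩, hpj⟩, fun R hR hRJ => ?_⟩,
    ⟨(N.mem_lowerRegions hS hm).2 ⟨(hm H hH).lt_of_le (not_lt.1 fun h => hHM
      ((N.mem_sepSet hm H).2 ⟨hH, h⟩)), q, hq, hqm⟩, fun R hR hMR => ?_⟩,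
    region A ν y, covers_of_sepSet_eq_insert hY hHY hinsJ, fun J' hJ' => ?_, hYM⟩
  · by_contra hJR
    exact hHM (hJM R hR.1 ⟨hRJ, hJR⟩ hR.2.2)
  · by_contra hRM
    exact hR.2.2 (hMJ R hR.1 ⟨hMR, hRM⟩ hHJ)
  · have hle : regLE A (region A ν b) J' (region A ν y) := fun K hK =>
      (hinsJ.subset (hJ'.2.1.1 hK)).resolve_left fun h =>
        hHM (hJM J' hJ'.1 hJ'.2.1 (h ▸ hK))
    refine N.region_eq_of_sepSet_eq hJ'.1 hY (hle.antisymm ?_)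
    by_contra hnot
    exact hJ'.2.2 _ hY ⟨hle, hnot⟩ (covers_of_sepSet_eq_insert hY hHY hinsJ).2.1

theorem subcritReg_of_shard (N : IsNormalSystem A b ν)
    {J M Jst : Set (EuclideanSpace ℝ (Fin n))} (hS : IsShardOf A (region A ν b) H Sg)
    (hJ : MinimalInU A (region A ν b) H Sg J) (hM : MaximalInL A (region A ν b) H Sg M)
    (huniq : ∀ J', CoversReg A (region A ν b) J J' → J' = Jst)
    (hle : regLE A (region A ν b) Jst M) : SubcritReg A (region A ν b) J M := by
  have hHJ := hJ.1.2.2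
  have hHM := hM.1.2.2
  refine ⟨hJ.1.1, hM.1.1, fun h => hHM (h hHJ), fun X hX hXJ => ?_, fun X hX hMX => ?_⟩
  · obtain ⟨Y, hXY, hcov⟩ := N.exists_covers_ge hX hXJ
    rw [huniq Y hcov] at hXY
    exact hXY.trans hle
  · obtain ⟨Y, hY, hHY, hins⟩ := N.exists_sepSet_eq_insert_of_mem_upperRegions hS hJ.1
    rw [← huniq Y (covers_of_sepSet_eq_insert hY hHY hins)] at hle
    exact hins.subset.trans
      (Set.insert_subset (N.mem_sepSet_of_maximalInL hS hM hX hMX) (hle.trans hMX.1))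

end IsNormalSystem

/-- **Proposition (Reading, Proposition 14).** A pair `(J,M)` of regions is subcritical in
𝒫(𝒜,B) if and only if there is a shard Σ such that `J` is minimal in U(Σ), `M` is maximal
in L(Σ), and `J_* ≤ M`, where `J_*` is the unique region covered by `J`. -/
theorem subcritical_iff_shard {n : ℕ}
    (A : Set (Set (EuclideanSpace ℝ (Fin n)))) (B : Set (EuclideanSpace ℝ (Fin n)))
    (hA : IsCentralArrangement A) (hB : IsRegion A B)
    (J M : Set (EuclideanSpace ℝ (Fin n))) (hJ : IsRegion A J) (hM : IsRegion A M) :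
    SubcritReg A B J M ↔
      ∃ H Sg, IsShardOf A B H Sg ∧ MinimalInU A B H Sg J ∧ MaximalInL A B H Sg M ∧
        ∃ Jst, CoversReg A B J Jst ∧ (∀ J', CoversReg A B J J' → J' = Jst) ∧
          regLE A B Jst M := by
  obtain ⟨b, ν, N, rfl⟩ := IsNormalSystem.exists_isNormalSystem hA hB
  refine ⟨N.exists_shard_of_subcritReg, ?_⟩
  rintro ⟨H, Sg, hS, hJU, hML, Jst, -, huniq, hle⟩
  exact N.subcritReg_of_shard hS hJU hML huniq hle
end
end
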